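/- Let τ ∈ ℍ, m₀, m₁, m₂, m₃ ∈ ℤ_{≥0} with Σ m_k ≥ 1, and let u be a solution of the curvature equation Δu + e^u = 8π Σ_{k=0}^{3} m_k δ_{ω_k/2} on E_τ. Set q(z) = −(1/2)(u_zz − (1/2)u_z²), where ∂_z = (1/2)(∂_x − i∂_y). Then q extends to an elliptic function with respect to Λ_τ, with poles of order 2 exactly at the lattice translates of the points ω_k/2 with m_k ≥ 1, and the linear ODE y″ = q·y is apparent at each of these singular points, i.e. every local solution near such a point is meromorphic (free of logarithmic singularity). -/

import Mathlib

open Metric Set Filter Topology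

noncomputable section

/-- The lattice `Λ_τ = ℤ + τℤ` as a set of complex numbers. -/
def lat (τ : ℂ) : Set ℂ := {z | ∃ m n : ℤ, z = (m : ℂ) + (n : ℂ) * τ}

/-- The lattice point `m + nτ` attached to a pair of integers. -/
def latPt (τ : ℂ) (p : ℤ × ℤ) : ℂ := (p.1 : ℂ) + (p.2 : ℂ) * τ

/-- The Weierstrass elliptic function `℘(z|τ)`. -/
def wp (τ z : ℂ) : ℂ :=
  1 / z ^ 2 + ∑' p : {p : ℤ × ℤ // p ≠ 0},
    (1 / (z - latPt τ p.1) ^ 2 - 1 / latPt τ p.1 ^ 2)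

/-- `℘′(z|τ)`. -/
def wpd (τ z : ℂ) : ℂ := deriv (wp τ) z

/-- `℘″(z|τ)`. -/
def wpdd (τ z : ℂ) : ℂ := deriv (deriv (wp τ)) z

/-- The Weierstrass zeta function `ζ(z|τ)` (odd primitive of `-℘`). -/
def wzeta (τ z : ℂ) : ℂ :=
  1 / z + ∑' p : {p : ℤ × ℤ // p ≠ 0},
    (1 / (z - latPt τ p.1) + 1 / latPt τ p.1 + z / latPt τ p.1 ^ 2)

/-- The Weierstrass sigma function `σ(z|τ)`. -/
def wsigma (τ z : ℂ) : ℂ :=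
  z * ∏' p : {p : ℤ × ℤ // p ≠ 0},
    ((1 - z / latPt τ p.1) * Complex.exp (z / latPt τ p.1 + z ^ 2 / (2 * latPt τ p.1 ^ 2)))

/-- The periods `ω₀ = 0, ω₁ = 1, ω₂ = τ, ω₃ = 1 + τ`. -/
def per (τ : ℂ) : ℕ → ℂ
  | 0 => 0
  | 1 => 1
  | 2 => τ
  | 3 => 1 + τ
  | _ => 0

/-- `e_k(τ) = ℘(ω_k/2|τ)`. -/
def eper (τ : ℂ) (k : ℕ) : ℂ := wp τ (per τ k / 2)

/-- The quasi-period `η₁(τ) = 2ζ(1/2|τ)`. -/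
def eta1 (τ : ℂ) : ℂ := 2 * wzeta τ (1 / 2)

/-- The quasi-period `η₂(τ) = 2ζ(τ/2|τ)`. -/
def eta2 (τ : ℂ) : ℂ := 2 * wzeta τ (τ / 2)

/-- `η_k(τ)`, with `η₃ = η₁ + η₂`. -/
def etaq (τ : ℂ) : ℕ → ℂ
  | 1 => eta1 τ
  | 2 => eta2 τ
  | 3 => eta1 τ + eta2 τ
  | _ => 0

/-- The Hecke form `Z(r,s,τ) = ζ(r+sτ|τ) - r η₁(τ) - s η₂(τ)`. -/
def heckeZ (r s τ : ℂ) : ℂ := wzeta τ (r + s * τ) - r * eta1 τ - s * eta2 τ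

/-- The pre-modular form `Z^{(𝐦_k)}(r,s,τ) = Z(r,s,τ)² - ℘(r+sτ|τ) + e_k(τ)`. -/
def heckeZm (k : ℕ) (r s τ : ℂ) : ℂ := heckeZ r s τ ^ 2 - wp τ (r + s * τ) + eper τ k

/-- First component of `(r_k, s_k)`. -/
def rkr (k : ℕ) (r : ℂ) : ℂ := if k = 2 then r else r + 1 / 2

/-- Second component of `(r_k, s_k)`. -/
def rks (k : ℕ) (s : ℂ) : ℂ := if k = 1 then s else s + 1 / 2

/-- `(r,s)` is a half-integer pair, i.e. belongs to `(1/2)ℤ²`. -/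
def IsHalfIntPair (r s : ℂ) : Prop := ∃ m n : ℤ, r = (m : ℂ) / 2 ∧ s = (n : ℂ) / 2

/-- The singular set of the curvature equation: lattice translates of the points `ω_k/2`
with `m_k ≥ 1`. -/
def singSet (τ : ℂ) (m : Fin 4 → ℕ) : Set ℂ :=
  {z | ∃ k : Fin 4, 1 ≤ m k ∧ ∃ l ∈ lat τ, z = per τ (k : ℕ) / 2 + l}

/-- The Laplacian of a real-valued function on `ℂ ≃ ℝ²`. -/
def lapl (u : ℂ → ℝ) (z : ℂ) : ℝ :=
  fderiv ℝ (fun w => fderiv ℝ u w (1 : ℂ)) z (1 : ℂ) +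
  fderiv ℝ (fun w => fderiv ℝ u w Complex.I) z Complex.I

/-- `u` is a solution of the curvature equation `Δu + e^u = 8π Σ m_k δ_{ω_k/2}` on `E_τ`. -/
def IsCurvatureSolution (τ : ℂ) (m : Fin 4 → ℕ) (u : ℂ → ℝ) : Prop :=
  (∀ z, u (z + 1) = u z) ∧ (∀ z, u (z + τ) = u z) ∧
  (∀ z ∉ singSet τ m, (∀ n : ℕ, ContDiffAt ℝ n u z) ∧ lapl u z + Real.exp (u z) = 0) ∧
  (∀ k : Fin 4, 1 ≤ m k → ∀ l ∈ lat τ,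
    ∃ C ε : ℝ, 0 < ε ∧ ∀ z : ℂ, z ≠ per τ (k : ℕ) / 2 + l →
      dist z (per τ (k : ℕ) / 2 + l) < ε →
      |u z - 4 * (m k : ℝ) * Real.log (dist z (per τ (k : ℕ) / 2 + l))| ≤ C)

/-- Multiplicities for equation `(★_k)`: `m₀ = m_k = 1`, the others `0`. -/
def starM (k : ℕ) : Fin 4 → ℕ := fun j => if (j : ℕ) = 0 ∨ (j : ℕ) = k then 1 else 0

/-- `f` is a developing map of `u`: `f` is meromorphic on `ℂ` and
`u = log (8|f′|²/(1+|f|²)²)` wherever `f` is analytic with nonvanishing derivative. -/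
def IsDevelopingMapOf (u : ℂ → ℝ) (f : ℂ → ℂ) : Prop :=
  (∀ z : ℂ, MeromorphicAt f z) ∧
  ∀ z : ℂ, AnalyticAt ℂ f z → deriv f z ≠ 0 →
    u z = Real.log (8 * ‖deriv f z‖ ^ 2 / (1 + ‖f z‖ ^ 2) ^ 2)

/-- `f` satisfies the type II constraint for the torus `E_τ`. -/
def IsTypeII (τ : ℂ) (f : ℂ → ℂ) : Prop :=
  ∃ θ₁ θ₂ : ℝ,
    (∀ z, f (z + 1) = Complex.exp (2 * Complex.I * (θ₁ : ℂ)) * f z) ∧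
    (∀ z, f (z + τ) = Complex.exp (2 * Complex.I * (θ₂ : ℂ)) * f z)

/-- The one-parameter family of solutions generated by the developing map `f`
(with members `u_β` having developing map `e^β f`) contains an even solution. -/
def FamilyHasEven (τ : ℂ) (m : Fin 4 → ℕ) (f : ℂ → ℂ) : Prop :=
  ∃ (β : ℝ) (v : ℂ → ℝ), IsCurvatureSolution τ m v ∧
    IsDevelopingMapOf v (fun z => (Real.exp β : ℂ) * f z) ∧ ∀ z, v (-z) = v z

/-- `u`, with type II developing map `f`, generates a non-even family of solutions. -/
def GeneratesNonEvenFamily (τ : ℂ) (m : Fin 4 → ℕ) (u : ℂ → ℝ) (f : ℂ → ℂ) : Prop :=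
  IsCurvatureSolution τ m u ∧ IsDevelopingMapOf u f ∧ IsTypeII τ f ∧ ¬ FamilyHasEven τ m f

/-- The curvature equation has a non-even family of solutions. -/
def HasNonEvenFamily (τ : ℂ) (m : Fin 4 → ℕ) : Prop :=
  ∃ u f, GeneratesNonEvenFamily τ m u f

/-- The curvature equation has an even family of solutions. -/
def HasEvenFamily (τ : ℂ) (m : Fin 4 → ℕ) : Prop :=
  ∃ (u : ℂ → ℝ) (f : ℂ → ℂ), IsCurvatureSolution τ m u ∧ IsDevelopingMapOf u f ∧
    IsTypeII τ f ∧ FamilyHasEven τ m f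

/-- `y` is a (meromorphic, global) solution of `y″ = q·y` away from the singular set `S`. -/
def SolvesODEOn (q : ℂ → ℂ) (S : Set ℂ) (y : ℂ → ℂ) : Prop :=
  (∀ z : ℂ, MeromorphicAt y z) ∧
  ∀ z ∉ S, AnalyticAt ℂ y z ∧ deriv (deriv y) z = q z * y z

/-- Linear independence of two functions, tested away from the singular set `S`. -/
def LinIndepOn (S : Set ℂ) (y₁ y₂ : ℂ → ℂ) : Prop :=
  ∀ a b : ℂ, (∀ z ∉ S, a * y₁ z + b * y₂ z = 0) → a = 0 ∧ b = 0

/-- The equation `y″ = q·y` (with singular set `S`) on `E_τ` has unitary monodromy: there is a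
fundamental system of solutions whose monodromy matrices w.r.t. `z ↦ z+1` and `z ↦ z+τ`
lie in `SU(2)`. -/
def HasUnitaryMonodromy (q : ℂ → ℂ) (S : Set ℂ) (τ : ℂ) : Prop :=
  ∃ y₁ y₂ : ℂ → ℂ, SolvesODEOn q S y₁ ∧ SolvesODEOn q S y₂ ∧ LinIndepOn S y₁ y₂ ∧
    ∃ M₁ M₂ : Matrix (Fin 2) (Fin 2) ℂ,
      M₁ ∈ Matrix.unitaryGroup (Fin 2) ℂ ∧ M₁.det = 1 ∧
      M₂ ∈ Matrix.unitaryGroup (Fin 2) ℂ ∧ M₂.det = 1 ∧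
      (∀ z, y₁ (z + 1) = M₁ 0 0 * y₁ z + M₁ 0 1 * y₂ z) ∧
      (∀ z, y₂ (z + 1) = M₁ 1 0 * y₁ z + M₁ 1 1 * y₂ z) ∧
      (∀ z, y₁ (z + τ) = M₂ 0 0 * y₁ z + M₂ 0 1 * y₂ z) ∧
      (∀ z, y₂ (z + τ) = M₂ 1 0 * y₁ z + M₂ 1 1 * y₂ z)

/-- The potential of the Fuchsian equation `L(𝐦_k, T, E, τ)`. -/
def LPot (k : ℕ) (T E τ : ℂ) (z : ℂ) : ℂ :=
  2 * wp τ z + 2 * wp τ (z - per τ k / 2) +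
    T * (wzeta τ (z - per τ k / 2) - wzeta τ z) - E

/-- The singular set of `L(𝐦_k, T, E, τ)`: lattice translates of `0` and `ω_k/2`. -/
def LSing (τ : ℂ) (k : ℕ) : Set ℂ := {z | ∃ l ∈ lat τ, z = l ∨ z = per τ k / 2 + l}

/-- The equation `y″ = q·y` is apparent (free of logarithmic singularity) at `p`: there are two
linearly independent single-valued solutions on a punctured neighborhood of `p`, both
meromorphic at `p`. -/
def ApparentAt (q : ℂ → ℂ) (p : ℂ) : Prop :=
  ∃ (y₁ y₂ : ℂ → ℂ) (ε : ℝ), 0 < ε ∧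
    (∀ z ∈ Metric.ball p ε, z ≠ p →
      AnalyticAt ℂ y₁ z ∧ AnalyticAt ℂ y₂ z ∧
      deriv (deriv y₁) z = q z * y₁ z ∧ deriv (deriv y₂) z = q z * y₂ z) ∧
    MeromorphicAt y₁ p ∧ MeromorphicAt y₂ p ∧
    ∀ a b : ℂ, (∀ z ∈ Metric.ball p ε, z ≠ p → a * y₁ z + b * y₂ z = 0) → a = 0 ∧ b = 0

/-- The translated (even) potential `q_k(z;T,E)` of `L(𝐦_k, T, E, τ)`. -/
def qPot (k : ℕ) (T E τ : ℂ) (z : ℂ) : ℂ :=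
  2 * (wp τ (z + per τ k / 4) + wp τ (z - per τ k / 4)) +
    T * (wzeta τ (z + per τ k / 4) - wzeta τ (z - per τ k / 4)) - E

/-- The singular set of the translated potential: lattice translates of `±ω_k/4`. -/
def qSing (τ : ℂ) (k : ℕ) : Set ℂ :=
  {z | ∃ l ∈ lat τ, z = per τ k / 4 + l ∨ z = -(per τ k / 4) + l}

/-- The even elliptic solution `Φ_e(z;T,E)` of the second symmetric product equation. -/
def PhiE (τ : ℂ) (k : ℕ) (T E : ℂ) (z : ℂ) : ℂ :=
  (wpd τ (per τ k / 4)) ^ 4 / (wp τ z - wp τ (per τ k / 4)) ^ 2 +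
  (wpd τ (per τ k / 4)) ^ 2 * (wpd τ (per τ k / 4) * T + wpdd τ (per τ k / 4)) /
      (wp τ z - wp τ (per τ k / 4)) +
  (1 / 4) * (4 * (wpd τ (per τ k / 4)) ^ 2 * E + 3 * (wpd τ (per τ k / 4)) ^ 2 * T ^ 2
    - 8 * wzeta τ (per τ k / 4) * (wpd τ (per τ k / 4)) ^ 2 * T
    + 32 * wp τ (per τ k / 4) * (wpd τ (per τ k / 4)) ^ 2
    - 3 * (wpdd τ (per τ k / 4)) ^ 2)

/-- For `k ∈ {1,2,3}`, the other two indices, so that `{k, i, i′} = {1,2,3}`. -/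
def otherTwo : ℕ → ℕ × ℕ
  | 1 => (2, 3)
  | 2 => (1, 3)
  | 3 => (1, 2)
  | _ => (0, 0)

/-- The Wirtinger derivative `∂_z g = (1/2)(∂_x g - i ∂_y g)`. -/
def wirt (g : ℂ → ℂ) (z : ℂ) : ℂ :=
  (1 / 2) * (fderiv ℝ g z (1 : ℂ) - Complex.I * fderiv ℝ g z Complex.I)

/-- The potential `q(z) = -(1/2)(u_zz - (1/2) u_z²)` associated with a solution `u`. -/
def uPot (u : ℂ → ℝ) (z : ℂ) : ℂ :=
  -(1 / 2) * (wirt (wirt (fun w => ((u w : ℝ) : ℂ))) z -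
    (1 / 2) * (wirt (fun w => ((u w : ℝ) : ℂ)) z) ^ 2)

/-- All lattice translates of the four half-periods. -/
def fullSing (τ : ℂ) : Set ℂ := {z | ∃ k : Fin 4, ∃ l ∈ lat τ, z = per τ (k : ℕ) / 2 + l}

/-- The potential of the general Fuchsian equation (with residues `T₁, T₂, T₃`). -/
def q8 (τ : ℂ) (m : Fin 4 → ℕ) (T₁ T₂ T₃ E : ℂ) (z : ℂ) : ℂ :=
  (∑ k : Fin 4, (m k : ℂ) * ((m k : ℂ) + 1) * wp τ (z - per τ (k : ℕ) / 2)) +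
  T₁ * (wzeta τ (z - per τ 1 / 2) - wzeta τ z) +
  T₂ * (wzeta τ (z - per τ 2 / 2) - wzeta τ z) +
  T₃ * (wzeta τ (z - per τ 3 / 2) - wzeta τ z) - E

/-- The elliptic-of-the-second-kind ansatz built from sigma functions. -/
def sigY (τ : ℂ) (k : ℕ) (a₁ a₂ c : ℂ) (z : ℂ) : ℂ :=
  Complex.exp (c * z) * wsigma τ (z - a₁) * wsigma τ (z - a₂) /
    (wsigma τ (z - per τ k / 4) * wsigma τ (z + per τ k / 4))

end


theorem ode_bound {E : Type*} [NormedAddCommGroup E] [NormedSpace ℂ E]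
    {f f' : ℝ → E} (n : ℕ) (C M : ℝ) (h0 : f 0 = 0)
    (hf : ∀ t ∈ Icc (0:ℝ) 1, HasDerivAt f (f' t) t)
    (hb : ∀ t ∈ Icc (0:ℝ) 1, ‖f' t‖ ≤ M * (C * (M * t) ^ n / n.factorial)) :
    ∀ t ∈ Icc (0:ℝ) 1, ‖f t‖ ≤ C * (M * t) ^ (n+1) / (n+1).factorial := by
  let _ : NormedSpace ℝ E := NormedSpace.restrictScalars ℝ ℂ E
  intro t ht
  refine image_norm_le_of_norm_deriv_right_le_deriv_boundary (a := 0) (b := 1) (f := f) (f' := f')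
    (B := fun t => C * (M * t) ^ (n+1) / (n+1).factorial)
    (B' := fun t => M * (C * (M * t) ^ n / n.factorial)) ?_ ?_ ?_ ?_ ?_ ht
  · intro x hx; exact (hf x hx).continuousAt.continuousWithinAt
  · intro x hx; exact (hf x ⟨hx.1, hx.2.le⟩).hasDerivWithinAt
  · simp [h0]
  · intro x
    have h1 : HasDerivAt (fun t : ℝ => M * t) M x := by simpa using (hasDerivAt_id x).const_mul M
    have := ((h1.pow (n+1)).const_mul C).div_const ((n+1).factorial : ℝ)
    convert! this using 1
    rw [Nat.factorial_succ]
    have : (n.factorial : ℝ) ≠ 0 := by positivity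
    push_cast
    field_simp
  · intro x hx; exact hb x ⟨hx.1, hx.2.le⟩

theorem ode_exists {E : Type*} [NormedAddCommGroup E] [NormedSpace ℂ E] [CompleteSpace E]
    {Ω : Set ℂ} (hΩ : Convex ℝ Ω) (hΩo : IsOpen Ω) (A : ℂ → E →L[ℂ] E)
    (hA : DifferentiableOn ℂ A Ω) {ζ₀ : ℂ} (h₀ : ζ₀ ∈ Ω) (Y₀ : E) :
    ∃ Y : ℂ → E, Y ζ₀ = Y₀ ∧ ∀ ζ ∈ Ω, HasDerivAt Y (A ζ (Y ζ)) ζ := by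
  have hP : ∀ f : ℂ → E, ∃ g : ℂ → E, DifferentiableOn ℂ f Ω →
      (g ζ₀ = 0 ∧ ∀ z ∈ Ω, HasDerivAt g (f z) z) := by
    intro f
    by_cases hf : DifferentiableOn ℂ f Ω
    · obtain ⟨g, hg⟩ := hΩ.exists_forall_hasDerivWithinAt hf
      refine ⟨fun z => g z - g ζ₀, fun _ => ⟨by simp, fun z hz => ?_⟩⟩
      exact ((hg z hz).hasDerivAt (hΩo.mem_nhds hz)).sub_const _
    · exact ⟨0, fun h => absurd h hf⟩
  choose P hP using hP
  let Yn : ℕ → ℂ → E := fun n => Nat.rec (fun _ => Y₀) (fun _ f => P (fun z => A z (f z))) n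
  have hdiff : ∀ n, DifferentiableOn ℂ (Yn n) Ω := by
    intro n
    induction n with
    | zero => exact differentiableOn_const _
    | succ n ih =>
      have := hP (fun z => A z (Yn n z)) (hA.clm_apply ih)
      exact fun z hz => (this.2 z hz).differentiableAt.differentiableWithinAt
  have hYs : ∀ n, Yn (n+1) ζ₀ = 0 ∧ ∀ z ∈ Ω, HasDerivAt (Yn (n+1)) (A z (Yn n z)) z :=
    fun n => hP (fun z => A z (Yn n z)) (hA.clm_apply (hdiff n))
  refine ⟨fun z => ∑' n, Yn n z, ?_, ?_⟩
  · show ∑' n, Yn n ζ₀ = Y₀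
    rw [tsum_eq_single 0]
    · rfl
    intro n hn
    obtain ⟨k, rfl⟩ := Nat.exists_eq_succ_of_ne_zero hn
    exact (hYs k).1
  intro ζ₁ h₁
  obtain ⟨δ, hδ, hball⟩ := Metric.nhds_basis_closedBall.mem_iff.1 (hΩo.mem_nhds h₁)
  let Φ : ℝ × ℂ → ℂ := fun q => ζ₀ + (q.1 : ℂ) * (q.2 - ζ₀)
  have hΦ : Continuous Φ := by fun_prop
  have hC : IsCompact (Icc (0:ℝ) 1 ×ˢ closedBall ζ₁ δ) :=
    isCompact_Icc.prod (isCompact_closedBall _ _)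
  have hΦΩ : ∀ t ∈ Icc (0:ℝ) 1, ∀ z ∈ closedBall ζ₁ δ, Φ (t, z) ∈ Ω := by
    intro t ht z hz
    have := hΩ.add_smul_sub_mem h₀ (hball hz) ht
    simpa [Φ] using this
  obtain ⟨K, hK⟩ := hC.exists_bound_of_continuousOn (f := fun q => A (Φ q))
    (hA.continuousOn.comp hΦ.continuousOn (fun q hq => hΦΩ q.1 hq.1 q.2 hq.2))
  have hK0 : 0 ≤ K := (norm_nonneg _).trans (hK (0, ζ₁) ⟨by simp, by simp [hδ.le]⟩)
  let D := δ + ‖ζ₁ - ζ₀‖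
  have hD : ∀ z ∈ closedBall ζ₁ δ, ‖z - ζ₀‖ ≤ D := by
    intro z hz
    have : z - ζ₀ = (z - ζ₁) + (ζ₁ - ζ₀) := by ring
    rw [this]
    refine (norm_add_le _ _).trans ?_
    have : ‖z - ζ₁‖ ≤ δ := by simpa [dist_eq_norm] using hz
    simp only [D]; linarith
  have hbd : ∀ n, ∀ z ∈ closedBall ζ₁ δ, ∀ t ∈ Icc (0:ℝ) 1,
      ‖Yn n (Φ (t, z))‖ ≤ ‖Y₀‖ * ((K * D) * t) ^ n / n.factorial := by
    intro n
    induction n with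
    | zero => intro z hz t ht; simp [Yn]
    | succ n ih =>
      intro z hz
      apply ode_bound n ‖Y₀‖ (K * D) (f := fun t => Yn (n+1) (Φ (t, z)))
        (f' := fun t => (z - ζ₀) • (A (Φ (t, z)) (Yn n (Φ (t, z)))))
      · simpa [Φ] using (hYs n).1
      · intro t ht
        have h1 := (hYs n).2 _ (hΦΩ t ht z hz)
        have h2 : HasDerivAt (fun t : ℝ => Φ (t, z)) (z - ζ₀) t := by
          have := ((Complex.ofRealCLM.hasDerivAt (x := t)).mul_const (z - ζ₀)).const_add ζ₀
          simpa [Φ] using this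
        exact h1.scomp t h2
      · intro t ht
        have h1 := ih z hz t ht
        have h2 := hK (t, z) ⟨ht, hz⟩
        rw [norm_smul]
        have hD0 : 0 ≤ D := (norm_nonneg _).trans (hD z hz)
        calc ‖z - ζ₀‖ * ‖A (Φ (t, z)) (Yn n (Φ (t, z)))‖
            ≤ D * (K * (‖Y₀‖ * (K * D * t) ^ n / n.factorial)) := by
              gcongr
              · exact hD z hz
              · refine ((A (Φ (t, z))).le_opNorm _).trans ?_
                gcongr
          _ = _ := by ring
  have hb1 : ∀ n, ∀ z ∈ closedBall ζ₁ δ, ‖Yn n z‖ ≤ ‖Y₀‖ * ((K * D)  ^ n / n.factorial) := by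
    intro n z hz
    have := hbd n z hz 1 (by simp)
    simpa [Φ, mul_div_assoc] using this
  have hA1 : ∀ z ∈ closedBall ζ₁ δ, ‖A z‖ ≤ K := by
    intro z hz
    have := hK (1, z) ⟨by simp, hz⟩
    simpa [Φ] using this
  have hsum : Summable fun n : ℕ => ‖Y₀‖ * ((K * D)  ^ n / n.factorial) :=
    (Real.summable_pow_div_factorial _).mul_left _
  have hsumY : ∀ z ∈ closedBall ζ₁ δ, Summable fun n => Yn n z := fun z hz =>
    Summable.of_norm_bounded hsum (fun n => hb1 n z hz)
  let g' : ℕ → ℂ → E := fun n z => match n with | 0 => 0 | n+1 => A z (Yn n z)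
  let b : ℕ → ℝ := fun n => match n with | 0 => 0 | n+1 => K * (‖Y₀‖ * ((K * D)  ^ n / n.factorial))
  have key := hasDerivAt_tsum_of_isPreconnected (g := Yn) (g' := g') (u := b) (t := ball ζ₁ δ)
    (y₀ := ζ₁) (y := ζ₁) ((summable_nat_add_iff 1).1 (by simpa [b] using hsum.mul_left K)) isOpen_ball
    (convex_ball _ _).isPreconnected ?_ ?_ (mem_ball_self hδ)
    (hsumY _ (mem_closedBall_self hδ.le)) (mem_ball_self hδ)
  · convert! key using 1
    have hs : Summable (fun n => A ζ₁ (Yn n ζ₁)) :=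
      (A ζ₁).summable (hsumY _ (mem_closedBall_self hδ.le))
    rw [(A ζ₁).map_tsum (hsumY _ (mem_closedBall_self hδ.le))]
    rw [Summable.tsum_eq_zero_add (f := fun n => g' n ζ₁) ((summable_nat_add_iff 1).1 (by simpa [g'] using hs))]
    simp [g']
  · intro n y hy
    cases n with
    | zero => exact hasDerivAt_const _ _
    | succ n => exact (hYs n).2 y (hball (ball_subset_closedBall hy))
  · intro n y hy
    cases n with
    | zero => simp [g', b]
    | succ n =>
      refine ((A y).le_opNorm _).trans ?_
      have h1 := hA1 y (ball_subset_closedBall hy)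
      have h2 := hb1 n y (ball_subset_closedBall hy)
      show _ ≤ K * _
      gcongr

/-- Wirtinger differentiability with `∂_z g = a`, `∂_z̄ g = b`. -/
def HW (g : ℂ → ℂ) (a b z : ℂ) : Prop :=
  HasFDerivAt (𝕜 := ℝ) g (a • (ContinuousLinearMap.id ℝ ℂ) +
    b • (Complex.conjCLE : ℂ →L[ℝ] ℂ)) z

theorem HW.congr' {g : ℂ → ℂ} {a b a' b' z : ℂ} (h : HW g a b z) (ha : a = a') (hb : b = b') :
    HW g a' b' z := by subst ha hb; exact h

theorem HW.add {g h : ℂ → ℂ} {a b c d z : ℂ} (hg : HW g a b z) (hh : HW h c d z) :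
    HW (fun x => g x + h x) (a + c) (b + d) z := by
  unfold HW at *
  convert! HasFDerivAt.add hg hh using 1
  module

theorem HW.sub {g h : ℂ → ℂ} {a b c d z : ℂ} (hg : HW g a b z) (hh : HW h c d z) :
    HW (fun x => g x - h x) (a - c) (b - d) z := by
  unfold HW at *
  convert! HasFDerivAt.sub hg hh using 1
  module

theorem HW.mul {g h : ℂ → ℂ} {a b c d z : ℂ} (hg : HW g a b z) (hh : HW h c d z) :
    HW (fun x => g x * h x) (a * h z + g z * c) (b * h z + g z * d) z := by
  unfold HW at *
  convert! HasFDerivAt.mul hg hh using 1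
  ext x; simp; ring

theorem HW.const_mul {g : ℂ → ℂ} {a b z : ℂ} (c : ℂ) (hg : HW g a b z) :
    HW (fun x => c * g x) (c * a) (c * b) z := by
  unfold HW at *
  convert! HasFDerivAt.const_mul hg c using 1
  ext x; simp; ring

theorem HW.conj {g : ℂ → ℂ} {a b z : ℂ} (hg : HW g a b z) :
    HW (fun x => (starRingEnd ℂ) (g x)) ((starRingEnd ℂ) b) ((starRingEnd ℂ) a) z := by
  unfold HW at *
  convert! (Complex.conjCLE.toContinuousLinearMap.hasFDerivAt (x := g z)).comp z hg using 1
  ext x; simp; ring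

theorem HW.of_hasDerivAt {f : ℂ → ℂ} {f' z : ℂ} (hf : HasDerivAt f f' z) : HW f f' 0 z := by
  unfold HW
  convert! hf.hasFDerivAt.restrictScalars ℝ using 1
  ext x; simp; ring

theorem HW.comp {g f : ℂ → ℂ} {a b f' z : ℂ} (hg : HW g a b (f z)) (hf : HasDerivAt f f' z) :
    HW (fun x => g (f x)) (f' * a) ((starRingEnd ℂ) f' * b) z := by
  have h1 := HW.of_hasDerivAt hf
  unfold HW at *
  convert! HasFDerivAt.comp z hg h1 using 1
  ext x; simp; ring

theorem HW.hol_comp {F g : ℂ → ℂ} {a b F' z : ℂ} (hF : HasDerivAt F F' (g z)) (hg : HW g a b z) :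
    HW (fun x => F (g x)) (F' * a) (F' * b) z := by
  have h1 := HW.of_hasDerivAt hF
  unfold HW at *
  convert! HasFDerivAt.comp z h1 hg using 1
  ext x; simp; ring

theorem HW.hasDerivAt {g : ℂ → ℂ} {a z : ℂ} (hg : HW g a 0 z) : HasDerivAt g a z := by
  unfold HW at hg
  rw [hasDerivAt_iff_hasFDerivAt]
  refine hasFDerivAt_of_restrictScalars ℝ hg ?_
  ext x; simp; ring

theorem HW.unique {g : ℂ → ℂ} {a b a' b' z : ℂ} (h : HW g a b z) (h' : HW g a' b' z) :
    a = a' ∧ b = b' := by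
  have := HasFDerivAt.unique h h'
  have h1 := congrArg (fun L => L (1:ℂ)) this
  have h2 := congrArg (fun L => L Complex.I) this
  simp at h1 h2
  have h3 : a - b = a' - b' := by
    have : Complex.I * (a - b) = Complex.I * (a' - b') := by linear_combination h2
    exact mul_left_cancel₀ Complex.I_ne_zero this
  constructor
  · linear_combination (h1 + h3) / 2
  · linear_combination (h1 - h3) / 2

theorem HW.congr_of_eventuallyEq {g h : ℂ → ℂ} {a b z : ℂ} (hg : HW g a b z)
    (e : h =ᶠ[𝓝 z] g) : HW h a b z := HasFDerivAt.congr_of_eventuallyEq hg e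

theorem HW.of_differentiableAt {g : ℂ → ℂ} {z : ℂ} (h : DifferentiableAt ℝ g z) :
    HW g ((1 / 2) * (fderiv ℝ g z 1 - Complex.I * fderiv ℝ g z Complex.I))
      ((1 / 2) * (fderiv ℝ g z 1 + Complex.I * fderiv ℝ g z Complex.I)) z := by
  unfold HW
  convert! h.hasFDerivAt using 1
  apply ContinuousLinearMap.coe_injective
  apply Complex.basisOneI.ext
  intro i
  fin_cases i
  · simp [Complex.coe_basisOneI]; ring
  · simp [Complex.coe_basisOneI]
    linear_combination (-fderiv ℝ g z Complex.I) * Complex.I_mul_I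

theorem HW.const_of_zero {g : ℂ → ℂ} {Ω : Set ℂ} (hΩ : Convex ℝ Ω) (hΩo : IsOpen Ω)
    (h : ∀ z ∈ Ω, HW g 0 0 z) {x y : ℂ} (hx : x ∈ Ω) (hy : y ∈ Ω) : g x = g y := by
  refine hΩ.is_const_of_fderivWithin_eq_zero (𝕜 := ℝ) (f := g) ?_ ?_ hx hy
  · intro z hz; exact HasFDerivAt.differentiableAt (h z hz) |>.differentiableWithinAt
  · intro z hz
    rw [fderivWithin_of_isOpen hΩo hz]
    rw [HasFDerivAt.fderiv (h z hz)]
    ext x; simp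

/-- left half plane -/
def HP (ε : ℝ) : Set ℂ := {ζ | ζ.re < Real.log ε}

theorem HP_convex (ε : ℝ) : Convex ℝ (HP ε) := convex_halfSpace_re_lt _

theorem HP_open (ε : ℝ) : IsOpen (HP ε) := isOpen_lt Complex.continuous_re continuous_const

theorem HP_shift {ε : ℝ} {ζ : ℂ} (h : ζ ∈ HP ε) : ζ + 2 * Real.pi * Complex.I ∈ HP ε := by
  simpa [HP] using h

theorem HP_exp {ε : ℝ} (hε : 0 < ε) {ζ p : ℂ} (h : ζ ∈ HP ε) :
    p + Complex.exp ζ ∈ ball p ε ∧ p + Complex.exp ζ ≠ p := by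
  refine ⟨?_, by simp [Complex.exp_ne_zero]⟩
  simp only [mem_ball, dist_eq_norm, add_sub_cancel_left, Complex.norm_exp]
  exact (Real.lt_log_iff_exp_lt hε).1 h

theorem HP_log {ε : ℝ} {z p : ℂ} (h : z ∈ ball p ε) (hz : z ≠ p) :
    Complex.log (z - p) ∈ HP ε := by
  simp only [HP, mem_ofPred_eq, Complex.log_re]
  have : 0 < ‖z - p‖ := by simpa [sub_eq_zero] using hz
  exact Real.log_lt_log this (by simpa [dist_eq_norm] using h)

theorem per_int {ε : ℝ} {G : ℂ → ℂ} (hG : ∀ ζ ∈ HP ε, G (ζ + 2 * Real.pi * Complex.I) = G ζ)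
    (n : ℤ) : ∀ ζ ∈ HP ε, G (ζ + n * (2 * Real.pi * Complex.I)) = G ζ := by
  have hm : ∀ (n : ℤ), ∀ ζ ∈ HP ε, ζ + n * (2 * Real.pi * Complex.I) ∈ HP ε := by
    intro n ζ hζ
    simpa [HP] using hζ
  induction n using Int.induction_on with
  | zero => intro ζ _; simp
  | succ n ih =>
    intro ζ hζ
    rw [← ih ζ hζ, ← hG _ (hm n ζ hζ)]
    congr 1; push_cast; ring
  | pred n ih =>
    intro ζ hζ
    rw [← ih ζ hζ, ← hG _ (hm _ ζ hζ)]
    congr 1; push_cast; ring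

theorem per_eq {ε : ℝ} {G : ℂ → ℂ} (hG : ∀ ζ ∈ HP ε, G (ζ + 2 * Real.pi * Complex.I) = G ζ)
    {x y : ℂ} (hx : x ∈ HP ε) (h : Complex.exp y = Complex.exp x) : G y = G x := by
  obtain ⟨n, rfl⟩ := Complex.exp_eq_exp_iff_exists_int.1 h
  exact per_int hG n x hx

theorem descend_exp {ε : ℝ} {G : ℂ → ℂ}
    (hG : ∀ ζ ∈ HP ε, G (ζ + 2 * Real.pi * Complex.I) = G ζ) (p : ℂ) {ζ : ℂ} (hζ : ζ ∈ HP ε) :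
    G (Complex.log (p + Complex.exp ζ - p)) = G ζ := by
  apply per_eq hG hζ
  rw [add_sub_cancel_left, Complex.exp_log (Complex.exp_ne_zero _)]

theorem descend_deriv {ε : ℝ} {G G' : ℂ → ℂ}
    (hG : ∀ ζ ∈ HP ε, G (ζ + 2 * Real.pi * Complex.I) = G ζ)
    (hd : ∀ ζ ∈ HP ε, HasDerivAt G (G' ζ) ζ) {p z : ℂ} (hz : z ∈ ball p ε) (hzp : z ≠ p) :
    HasDerivAt (fun z => G (Complex.log (z - p))) (G' (Complex.log (z - p)) / (z - p)) z := by
  have hz0 : z - p ≠ 0 := sub_ne_zero.2 hzp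
  let L : ℂ → ℂ := fun x => Complex.log (z - p) + Complex.log ((x - p) / (z - p))
  have hLz : L z = Complex.log (z - p) := by simp [L, div_self hz0]
  have hL : HasDerivAt L (1 / (z - p)) z := by
    have h1 : HasDerivAt (fun x => (x - p) / (z - p)) (1 / (z - p)) z :=
      ((hasDerivAt_id z).sub_const p).div_const _
    have h2 := (h1.clog (by simp [div_self hz0])).const_add (Complex.log (z - p))
    simpa [L, div_self hz0] using h2
  have h3 : HasDerivAt (fun x => G (L x)) (G' (Complex.log (z - p)) * (1 / (z - p))) z := by
    have := hd _ (HP_log hz hzp)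
    rw [← hLz] at this ⊢
    exact this.comp z hL
  rw [mul_one_div] at h3
  refine h3.congr_of_eventuallyEq ?_
  have hopen : IsOpen (ball p ε ∩ {p}ᶜ) := isOpen_ball.inter isOpen_compl_singleton
  filter_upwards [hopen.mem_nhds ⟨hz, hzp⟩] with x hx
  symm
  apply per_eq hG (HP_log hx.1 hx.2)
  have hx0 : x - p ≠ 0 := sub_ne_zero.2 hx.2
  simp only [L]
  rw [Complex.exp_add, Complex.exp_log hz0, Complex.exp_log (div_ne_zero hx0 hz0),
    Complex.exp_log hx0]
  field_simp

theorem descend_ext {ε : ℝ} (hε : 0 < ε) {G G' : ℂ → ℂ} {s C : ℝ} (hs : s < 1)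
    (hG : ∀ ζ ∈ HP ε, G (ζ + 2 * Real.pi * Complex.I) = G ζ)
    (hd : ∀ ζ ∈ HP ε, HasDerivAt G (G' ζ) ζ)
    (hb : ∀ ζ ∈ HP ε, ‖G ζ‖ ≤ C * Real.exp (-s * ζ.re)) (p : ℂ) :
    ∃ g : ℂ → ℂ, AnalyticAt ℂ g p ∧ ∀ ζ ∈ HP ε, g (p + Complex.exp ζ) = G ζ := by
  let f : ℂ → ℂ := fun z => G (Complex.log (z - p))
  have hfd : DifferentiableOn ℂ f (ball p ε \ {p}) := fun z hz =>
    (descend_deriv hG hd hz.1 hz.2).differentiableAt.differentiableWithinAt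
  have hC : 0 ≤ C := by
    have h1 := hb ((Real.log ε - 1 : ℝ) : ℂ) (by simp [HP])
    have h2 := (norm_nonneg _).trans h1
    exact nonneg_of_mul_nonneg_left h2 (Real.exp_pos _)
  have hlim : Tendsto (fun z : ℂ => ‖z - p‖ ^ (1 - s)) (𝓝[≠] p) (𝓝 0) := by
    have h1 : Continuous (fun z : ℂ => ‖z - p‖ ^ (1 - s)) :=
      (continuous_norm.comp (continuous_sub_right p)).rpow_const (fun _ => Or.inr (by linarith))
    have := (h1.tendsto p).mono_left (nhdsWithin_le_nhds (s := {p}ᶜ))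
    simpa [Real.zero_rpow (by linarith : 1 - s ≠ 0)] using this
  have ho : (fun z => f z - f p) =o[𝓝[≠] p] fun z => (z - p)⁻¹ := by
    apply Asymptotics.IsLittleO.sub
    · rw [Asymptotics.isLittleO_iff]
      intro c hc
      have h1 : ∀ᶠ z in 𝓝[≠] p, C * ‖z - p‖ ^ (1 - s) < c := by
        have := hlim.const_mul C
        rw [mul_zero] at this
        exact this.eventually (gt_mem_nhds hc)
      have h2 : ∀ᶠ z in 𝓝[≠] p, z ∈ ball p ε := mem_nhdsWithin_of_mem_nhds (ball_mem_nhds p hε)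
      filter_upwards [h1, h2, self_mem_nhdsWithin] with z hz1 hz2 hz3
      have hz0 : 0 < ‖z - p‖ := by simpa [sub_eq_zero] using hz3
      have := hb _ (HP_log hz2 hz3)
      rw [Complex.log_re] at this
      rw [norm_inv, ← div_eq_mul_inv, le_div_iff₀ hz0]
      refine le_trans ?_ hz1.le
      calc ‖f z‖ * ‖z - p‖ ≤ (C * Real.exp (-s * Real.log ‖z - p‖)) * ‖z - p‖ := by gcongr
        _ = C * ‖z - p‖ ^ (1 - s) := by
          rw [sub_eq_add_neg 1 s, Real.rpow_add hz0, Real.rpow_one, Real.rpow_def_of_pos hz0 (-s)]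
          ring_nf
    · have := Asymptotics.isLittleO_const_left (E'' := ℂ) (F'' := ℂ) (c := f p) (g'' := fun z : ℂ => (z - p)⁻¹) (l := 𝓝[≠] p)
      rw [this]
      right
      have h1 : Tendsto (fun z : ℂ => ‖z - p‖) (𝓝[≠] p) (𝓝[>] 0) :=
        tendsto_norm_sub_self_nhdsNE p
      have := h1.inv_tendsto_nhdsGT_zero
      refine this.congr ?_
      intro z; simp
  have := Complex.differentiableOn_update_limUnder_of_isLittleO (ball_mem_nhds p hε) hfd ho
  refine ⟨_, this.analyticAt (ball_mem_nhds p hε), ?_⟩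
  intro ζ hζ
  rw [Function.update_of_ne (HP_exp hε hζ).2]
  exact descend_exp hG p hζ

/-- Local data. -/
structure LD (p : ℂ) (ε : ℝ) (Q w wz wb ws : ℂ → ℂ) : Prop where
  hw : ∀ z ∈ ball p ε, z ≠ p → HW w (wz z) (wb z) z
  hwz : ∀ z ∈ ball p ε, z ≠ p → HW wz (Q z * w z) (ws z) z
  hwb : ∀ z ∈ ball p ε, z ≠ p → HW wb (ws z) ((starRingEnd ℂ) (Q z) * w z) z
  hws : ∀ z ∈ ball p ε, z ≠ p → HW ws (Q z * wb z) ((starRingEnd ℂ) (Q z) * wz z) z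
  hdet : ∀ z ∈ ball p ε, z ≠ p → w z * ws z - wz z * wb z = 1 / 8
  hQ : ∀ z ∈ ball p ε, z ≠ p → DifferentiableAt ℂ Q z
  hcon : ∀ z ∈ ball p ε, z ≠ p → wb z = (starRingEnd ℂ) (wz z)
  hwr : ∀ z ∈ ball p ε, z ≠ p → ∃ r : ℝ, 0 < r ∧ w z = r
  hsr : ∀ z ∈ ball p ε, z ≠ p → ∃ r : ℝ, ws z = r

/-- Solutions upstairs. -/
def Sol (p : ℂ) (ε : ℝ) (Q y v : ℂ → ℂ) : Prop :=
  ∀ ζ ∈ HP ε, HasDerivAt y (Complex.exp ζ * v ζ) ζ ∧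
    HasDerivAt v (Complex.exp ζ * (Q (p + Complex.exp ζ) * y ζ)) ζ

/-- The hermitian form. -/
noncomputable def Kf (p : ℂ) (w wz wb ws y₁ v₁ y₂ v₂ : ℂ → ℂ) (ζ : ℂ) : ℂ :=
  v₁ ζ * (starRingEnd ℂ) (v₂ ζ) * w (p + Complex.exp ζ)
  - y₁ ζ * (starRingEnd ℂ) (v₂ ζ) * wz (p + Complex.exp ζ)
  - v₁ ζ * (starRingEnd ℂ) (y₂ ζ) * wb (p + Complex.exp ζ)
  + y₁ ζ * (starRingEnd ℂ) (y₂ ζ) * ws (p + Complex.exp ζ)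

theorem hasDerivAt_E (p ζ : ℂ) : HasDerivAt (fun ζ => p + Complex.exp ζ) (Complex.exp ζ) ζ :=
  (Complex.hasDerivAt_exp ζ).const_add p

theorem sol_exists {p : ℂ} {ε : ℝ} (hε : 0 < ε) {Q : ℂ → ℂ}
    (hQ : ∀ z ∈ ball p ε, z ≠ p → DifferentiableAt ℂ Q z) {ζ₀ : ℂ} (h₀ : ζ₀ ∈ HP ε) (a b : ℂ) :
    ∃ y v, Sol p ε Q y v ∧ y ζ₀ = a ∧ v ζ₀ = b := by
  let L1 : ℂ × ℂ →L[ℂ] ℂ × ℂ := (ContinuousLinearMap.snd ℂ ℂ ℂ).prod 0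
  let L2 : ℂ × ℂ →L[ℂ] ℂ × ℂ := (0 : ℂ × ℂ →L[ℂ] ℂ).prod (ContinuousLinearMap.fst ℂ ℂ ℂ)
  obtain ⟨Y, hY0, hY⟩ := ode_exists (HP_convex ε) (HP_open ε)
    (fun ζ => Complex.exp ζ • L1 + (Complex.exp ζ * Q (p + Complex.exp ζ)) • L2) (by
      intro ζ hζ
      have h1 := hQ _ (HP_exp hε hζ (p := p)).1 (HP_exp hε hζ).2
      have h2 : DifferentiableAt ℂ (fun ζ => Q (p + Complex.exp ζ)) ζ :=
        DifferentiableAt.comp ζ h1 (hasDerivAt_E p ζ).differentiableAt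
      have h3 : DifferentiableAt ℂ Complex.exp ζ := Complex.differentiableAt_exp
      exact ((h3.smul_const L1).add ((h3.mul h2).smul_const L2)).differentiableWithinAt)
    h₀ (a, b)
  refine ⟨fun ζ => (Y ζ).1, fun ζ => (Y ζ).2, ?_, by simp [hY0], by simp [hY0]⟩
  intro ζ hζ
  have h := hY ζ hζ
  have h1 := (ContinuousLinearMap.fst ℂ ℂ ℂ).hasFDerivAt.comp_hasDerivAt ζ h
  have h2 := (ContinuousLinearMap.snd ℂ ℂ ℂ).hasFDerivAt.comp_hasDerivAt ζ h
  constructor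
  · convert! h1 using 1
    simp [L1, L2]
  · convert! h2 using 1
    simp [L1, L2]
    ring

theorem Sol.lin {p : ℂ} {ε : ℝ} {Q y₁ v₁ y₂ v₂ : ℂ → ℂ} (h1 : Sol p ε Q y₁ v₁)
    (h2 : Sol p ε Q y₂ v₂) (a b : ℂ) :
    Sol p ε Q (fun ζ => a * y₁ ζ + b * y₂ ζ) (fun ζ => a * v₁ ζ + b * v₂ ζ) := by
  intro ζ hζ
  constructor
  · convert! ((h1 ζ hζ).1.const_mul a).add ((h2 ζ hζ).1.const_mul b) using 1
    ring
  · convert! ((h1 ζ hζ).2.const_mul a).add ((h2 ζ hζ).2.const_mul b) using 1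
    ring

theorem exp_shift (ζ : ℂ) : Complex.exp (ζ + 2 * Real.pi * Complex.I) = Complex.exp ζ :=
  Complex.exp_periodic ζ

theorem Sol.shift {p : ℂ} {ε : ℝ} {Q y v : ℂ → ℂ} (h : Sol p ε Q y v) :
    Sol p ε Q (fun ζ => y (ζ + 2 * Real.pi * Complex.I))
      (fun ζ => v (ζ + 2 * Real.pi * Complex.I)) := by
  intro ζ hζ
  have := h _ (HP_shift hζ)
  rw [exp_shift] at this
  exact ⟨this.1.comp_add_const _ _, this.2.comp_add_const _ _⟩

theorem wr_const {p : ℂ} {ε : ℝ} {Q y₁ v₁ y₂ v₂ : ℂ → ℂ} (h1 : Sol p ε Q y₁ v₁)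
    (h2 : Sol p ε Q y₂ v₂) {x y : ℂ} (hx : x ∈ HP ε) (hy : y ∈ HP ε) :
    y₁ x * v₂ x - y₂ x * v₁ x = y₁ y * v₂ y - y₂ y * v₁ y := by
  apply HW.const_of_zero (HP_convex ε) (HP_open ε) (g := fun x => y₁ x * v₂ x - y₂ x * v₁ x) _ hx hy
  intro z hz
  have := ((h1 z hz).1.mul (h2 z hz).2).sub ((h2 z hz).1.mul (h1 z hz).2)
  refine (HW.of_hasDerivAt this).congr' ?_ rfl
  ring

theorem K_const {p : ℂ} {ε : ℝ} (hε : 0 < ε) {Q w wz wb ws y₁ v₁ y₂ v₂ : ℂ → ℂ}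
    (D : LD p ε Q w wz wb ws) (h1 : Sol p ε Q y₁ v₁)
    (h2 : Sol p ε Q y₂ v₂) {x y : ℂ} (hx : x ∈ HP ε) (hy : y ∈ HP ε) :
    Kf p w wz wb ws y₁ v₁ y₂ v₂ x = Kf p w wz wb ws y₁ v₁ y₂ v₂ y := by
  apply HW.const_of_zero (HP_convex ε) (HP_open ε) _ hx hy
  intro z hz
  have hy1 := HW.of_hasDerivAt (h1 z hz).1
  have hv1 := HW.of_hasDerivAt (h1 z hz).2
  have hy2 := (HW.of_hasDerivAt (h2 z hz).1).conj
  have hv2 := (HW.of_hasDerivAt (h2 z hz).2).conj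
  have hE := HP_exp hε hz (p := p)
  have e1 := HW.comp (f := fun ζ => p + Complex.exp ζ) (D.hw _ hE.1 hE.2) (hasDerivAt_E p z)
  have e2 := HW.comp (f := fun ζ => p + Complex.exp ζ) (D.hwz _ hE.1 hE.2) (hasDerivAt_E p z)
  have e3 := HW.comp (f := fun ζ => p + Complex.exp ζ) (D.hwb _ hE.1 hE.2) (hasDerivAt_E p z)
  have e4 := HW.comp (f := fun ζ => p + Complex.exp ζ) (D.hws _ hE.1 hE.2) (hasDerivAt_E p z)
  have := ((((hv1.mul hv2).mul e1).sub ((hy1.mul hv2).mul e2)).sub ((hv1.mul hy2).mul e3)).add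
    ((hy1.mul hy2).mul e4)
  refine this.congr' ?_ ?_
  · simp only [map_mul, map_zero]; ring
  · simp only [map_mul, map_zero]; ring

theorem K_pos {p : ℂ} {ε : ℝ} (hε : 0 < ε) {Q w wz wb ws : ℂ → ℂ} (y v : ℂ → ℂ)
    (D : LD p ε Q w wz wb ws) {ζ : ℂ} (hζ : ζ ∈ HP ε) :
    ∃ k r : ℝ, w (p + Complex.exp ζ) = r ∧ Kf p w wz wb ws y v y v ζ = k ∧ 0 < r ∧
      ‖y ζ‖ ^ 2 ≤ 8 * k * r ∧ ((y ζ ≠ 0 ∨ v ζ ≠ 0) → 0 < k) := by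
  have hE := HP_exp hε hζ (p := p)
  obtain ⟨r, hr, hwr⟩ := D.hwr _ hE.1 hE.2
  have hdet := D.hdet _ hE.1 hE.2
  have hcon := D.hcon _ hE.1 hE.2
  have hrC : (r : ℂ) ≠ 0 := by exact_mod_cast hr.ne'
  let k : ℝ := (‖v ζ * r - y ζ * wz (p + Complex.exp ζ)‖ ^ 2 + ‖y ζ‖ ^ 2 / 8) / r
  refine ⟨k, r, hwr, ?_, hr, ?_, ?_⟩
  · simp only [Kf, k]
    push_cast
    rw [eq_div_iff hrC, ← Complex.conj_mul', ← Complex.conj_mul', map_sub, map_mul, map_mul,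
      Complex.conj_ofReal, ← hcon, hwr]
    rw [hwr] at hdet
    linear_combination (y ζ * (starRingEnd ℂ) (y ζ)) * hdet
  · have : 8 * k * r = 8 * (‖v ζ * r - y ζ * wz (p + Complex.exp ζ)‖ ^ 2 + ‖y ζ‖ ^ 2 / 8) := by
      simp only [k]; field_simp
    rw [this]
    nlinarith [sq_nonneg ‖v ζ * r - y ζ * wz (p + Complex.exp ζ)‖]
  · intro h
    apply div_pos _ hr
    by_cases hy : y ζ = 0
    · have hv : v ζ ≠ 0 := by tauto
      have : 0 < ‖v ζ * r - y ζ * wz (p + Complex.exp ζ)‖ := by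
        rw [hy]; simp [hv, hr.ne']
      positivity
    · have : 0 < ‖y ζ‖ := by simpa using hy
      positivity

theorem K_conj {p : ℂ} {ε : ℝ} (hε : 0 < ε) {Q w wz wb ws : ℂ → ℂ} (y v y' v' : ℂ → ℂ)
    (D : LD p ε Q w wz wb ws) {ζ : ℂ} (hζ : ζ ∈ HP ε) :
    Kf p w wz wb ws y' v' y v ζ = (starRingEnd ℂ) (Kf p w wz wb ws y v y' v' ζ) := by
  have hE := HP_exp hε hζ (p := p)
  obtain ⟨r, hr, hwr⟩ := D.hwr _ hE.1 hE.2
  obtain ⟨s, hsr⟩ := D.hsr _ hE.1 hE.2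
  have hcon := D.hcon _ hE.1 hE.2
  simp only [Kf, hwr, hsr, hcon, map_add, map_sub, map_mul, Complex.conj_conj, Complex.conj_ofReal]
  ring

theorem w_repr {p : ℂ} {w wz wb ws : ℂ → ℂ} (y v y' v' : ℂ → ℂ) (ζ : ℂ)
    (hW : y ζ * v' ζ - y' ζ * v ζ = 1)
    (h1 : Kf p w wz wb ws y v y' v' ζ = 0) (h2 : Kf p w wz wb ws y' v' y v ζ = 0) :
    w (p + Complex.exp ζ) = (‖y' ζ‖ : ℂ) ^ 2 * Kf p w wz wb ws y v y v ζ +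
      (‖y ζ‖ : ℂ) ^ 2 * Kf p w wz wb ws y' v' y' v' ζ := by
  have hW' := congrArg (starRingEnd ℂ) hW
  simp only [map_sub, map_mul, map_one] at hW'
  rw [← Complex.conj_mul', ← Complex.conj_mul']
  have : w (p + Complex.exp ζ) = (y ζ * v' ζ - y' ζ * v ζ) *
    ((starRingEnd ℂ) (y ζ) * (starRingEnd ℂ) (v' ζ) - (starRingEnd ℂ) (y' ζ) * (starRingEnd ℂ) (v ζ))
     * w (p + Complex.exp ζ) := by rw [hW, hW']; ring
  rw [this]
  have e : ∀ a b : ℂ, a = b + y' ζ * (starRingEnd ℂ) (y ζ) * Kf p w wz wb ws y v y' v' ζ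
    + y ζ * (starRingEnd ℂ) (y' ζ) * Kf p w wz wb ws y' v' y v ζ → a = b := by
    intro a b h; rw [h, h1, h2]; ring
  clear this hW hW'
  symm
  apply e
  simp only [Kf]
  ring

theorem sol_span {p : ℂ} {ε : ℝ} {Q y v y' v' x w : ℂ → ℂ} (hY : Sol p ε Q y v)
    (hZ : Sol p ε Q y' v') (hX : Sol p ε Q x w)
    (hW : ∀ ζ ∈ HP ε, y ζ * v' ζ - y' ζ * v ζ = 1) {ζ₀ : ℂ} (h₀ : ζ₀ ∈ HP ε) :
    ∃ a b : ℂ, ∀ ζ ∈ HP ε, x ζ = a * y ζ + b * y' ζ ∧ w ζ = a * v ζ + b * v' ζ := by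
  refine ⟨x ζ₀ * v' ζ₀ - y' ζ₀ * w ζ₀, y ζ₀ * w ζ₀ - x ζ₀ * v ζ₀, ?_⟩
  intro ζ hζ
  rw [wr_const hX hZ h₀ hζ, wr_const hY hX h₀ hζ]
  have := hW ζ hζ
  constructor
  · linear_combination (-x ζ) * this
  · linear_combination (-w ζ) * this

theorem eigen_exists {p : ℂ} {ε : ℝ} (hε : 0 < ε) {Q : ℂ → ℂ}
    (hQ : ∀ z ∈ ball p ε, z ≠ p → DifferentiableAt ℂ Q z) {ζ₀ : ℂ} (h₀ : ζ₀ ∈ HP ε) :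
    ∃ (y v : ℂ → ℂ) (l : ℂ), Sol p ε Q y v ∧ (y ζ₀ ≠ 0 ∨ v ζ₀ ≠ 0) ∧
      ∀ ζ ∈ HP ε, y (ζ + 2 * Real.pi * Complex.I) = l * y ζ ∧
        v (ζ + 2 * Real.pi * Complex.I) = l * v ζ := by
  obtain ⟨y1, v1, S1, a1, b1⟩ := sol_exists hε hQ h₀ 1 0
  obtain ⟨y2, v2, S2, a2, b2⟩ := sol_exists hε hQ h₀ 0 1
  have hW : ∀ ζ ∈ HP ε, y1 ζ * v2 ζ - y2 ζ * v1 ζ = 1 := by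
    intro ζ hζ
    rw [wr_const S1 S2 hζ h₀, a1, b1, a2, b2]; ring
  obtain ⟨a, b, h1⟩ := sol_span S1 S2 S1.shift hW h₀
  obtain ⟨c, d, h2⟩ := sol_span S1 S2 S2.shift hW h₀
  by_cases hc : c = 0
  · refine ⟨y2, v2, d, S2, Or.inr (by rw [b2]; exact one_ne_zero), ?_⟩
    intro ζ hζ
    have := h2 ζ hζ
    simp only [hc, zero_mul, zero_add] at this
    exact this
  · obtain ⟨s, hs⟩ := IsAlgClosed.exists_pow_nat_eq ((a + d) ^ 2 - 4 * (a * d - b * c))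
      (n := 2) (by norm_num)
    refine ⟨_, _, (a + d + s) / 2, S1.lin S2 c ((a + d + s) / 2 - a), Or.inl ?_, ?_⟩
    · simp [a1, a2, hc]
    · intro ζ hζ
      have g1 := h1 ζ hζ
      have g2 := h2 ζ hζ
      constructor
      · show c * y1 _ + _ * y2 _ = _
        rw [g1.1, g2.1]
        linear_combination (-y2 ζ / 4) * hs
      · show c * v1 _ + _ * v2 _ = _
        rw [g1.2, g2.2]
        linear_combination (-v2 ζ / 4) * hs

theorem K_shift {p : ℂ} {w wz wb ws y v y' v' : ℂ → ℂ} {ζ l l' : ℂ}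
    (h : y (ζ + 2 * Real.pi * Complex.I) = l * y ζ ∧ v (ζ + 2 * Real.pi * Complex.I) = l * v ζ)
    (h' : y' (ζ + 2 * Real.pi * Complex.I) = l' * y' ζ ∧
      v' (ζ + 2 * Real.pi * Complex.I) = l' * v' ζ) :
    Kf p w wz wb ws y v y' v' (ζ + 2 * Real.pi * Complex.I) =
      l * (starRingEnd ℂ) l' * Kf p w wz wb ws y v y' v' ζ := by
  simp only [Kf, exp_shift, h.1, h.2, h'.1, h'.2, map_mul]
  ring

theorem pair_exists {p : ℂ} {ε : ℝ} (hε : 0 < ε) {Q w wz wb ws : ℂ → ℂ}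
    (D : LD p ε Q w wz wb ws) :
    ∃ (y v y' v' : ℂ → ℂ) (l l' : ℂ) (k k' : ℝ), Sol p ε Q y v ∧ Sol p ε Q y' v' ∧
      ‖l‖ = 1 ∧ l * l' = 1 ∧
      (∀ ζ ∈ HP ε, y ζ * v' ζ - y' ζ * v ζ = 1) ∧
      (∀ ζ ∈ HP ε, y (ζ + 2 * Real.pi * Complex.I) = l * y ζ ∧
        v (ζ + 2 * Real.pi * Complex.I) = l * v ζ) ∧
      (∀ ζ ∈ HP ε, y' (ζ + 2 * Real.pi * Complex.I) = l' * y' ζ ∧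
        v' (ζ + 2 * Real.pi * Complex.I) = l' * v' ζ) ∧
      0 ≤ k ∧ 0 ≤ k' ∧
      (∀ ζ ∈ HP ε, ∃ r : ℝ, w (p + Complex.exp ζ) = r ∧ ‖y ζ‖ ^ 2 ≤ 8 * k * r ∧
        ‖y' ζ‖ ^ 2 ≤ 8 * k' * r ∧ r = ‖y' ζ‖ ^ 2 * k + ‖y ζ‖ ^ 2 * k') := by
  have h₀ : ((Real.log ε - 1 : ℝ) : ℂ) ∈ HP ε := by
    simp only [HP, mem_ofPred_eq, Complex.ofReal_re]; linarith
  generalize ((Real.log ε - 1 : ℝ) : ℂ) = ζ₀ at h₀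
  obtain ⟨y, v, l, S1, hne, hsh⟩ := eigen_exists hε D.hQ h₀
  obtain ⟨k, r, -, hk, -, -, hkpos⟩ := K_pos hε y v D h₀
  have hk0 := hkpos hne
  have hkC : (k : ℂ) ≠ 0 := by exact_mod_cast hk0.ne'
  have hl : ‖l‖ = 1 := by
    have e := K_shift (p := p) (w := w) (wz := wz) (wb := wb) (ws := ws) (hsh ζ₀ h₀) (hsh ζ₀ h₀)
    rw [K_const hε D S1 S1 (HP_shift h₀) h₀, hk, Complex.mul_conj'] at e
    have : (‖l‖ : ℂ) ^ 2 = 1 := by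
      apply mul_right_cancel₀ hkC
      rw [← e, one_mul]
    have h2 : ‖l‖ ^ 2 = 1 := by exact_mod_cast this
    nlinarith [norm_nonneg l]
  have hl0 : l ≠ 0 := by
    rintro rfl; simp at hl
  let E := p + Complex.exp ζ₀
  obtain ⟨y', v', S2, hy', hv'⟩ := sol_exists hε D.hQ h₀
    ((1 / k) * -((starRingEnd ℂ) (v ζ₀) * w E - (starRingEnd ℂ) (y ζ₀) * wb E))
    ((1 / k) * (-(starRingEnd ℂ) (v ζ₀) * wz E + (starRingEnd ℂ) (y ζ₀) * ws E))
  have hW : ∀ ζ ∈ HP ε, y ζ * v' ζ - y' ζ * v ζ = 1 := by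
    intro ζ hζ
    rw [wr_const S1 S2 hζ h₀, hy', hv']
    simp only [Kf] at hk
    field_simp
    simp only [E]
    linear_combination hk
  have hK : ∀ ζ ∈ HP ε, Kf p w wz wb ws y' v' y v ζ = 0 := by
    intro ζ hζ
    rw [K_const hε D S2 S1 hζ h₀]
    simp only [Kf, hy', hv', E]
    ring
  obtain ⟨c, d, hcd⟩ := sol_span S1 S2 S2.shift hW h₀
  have hc : c = 0 := by
    have e1 := hK _ (HP_shift h₀)
    have e2 := hK _ h₀
    have g1 := hcd _ h₀
    have g2 := hsh _ h₀
    simp only [Kf] at hk e1 e2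
    simp only [exp_shift, g1.1, g1.2, g2.1, g2.2, map_mul] at e1
    have hcl : (starRingEnd ℂ) l ≠ 0 := by simpa using hl0
    have : c * ((starRingEnd ℂ) l * k) = 0 := by
      linear_combination e1 - c * (starRingEnd ℂ) l * hk - d * (starRingEnd ℂ) l * e2
    rcases mul_eq_zero.1 this with h | h
    · exact h
    · exact absurd h (mul_ne_zero hcl hkC)
  subst hc
  simp only [zero_mul, zero_add] at hcd
  obtain ⟨k', r', -, hk', hr', hb', -⟩ := K_pos hε y' v' D h₀
  refine ⟨y, v, y', v', l, d, k, k', S1, S2, hl, ?_, hW, hsh, hcd, hk0.le, ?_, ?_⟩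
  · have e1 := hW _ (HP_shift h₀)
    have g1 := hcd _ h₀
    have g2 := hsh _ h₀
    rw [g1.1, g1.2, g2.1, g2.2] at e1
    linear_combination e1 - l * d * hW _ h₀
  · by_contra hneg
    push Not at hneg
    nlinarith [sq_nonneg ‖y' ζ₀‖, mul_neg_of_neg_of_pos hneg hr']
  · intro ζ hζ
    obtain ⟨k1, r1, hw1, hk1, hr1, hb1, -⟩ := K_pos hε y v D hζ
    obtain ⟨k2, r2, hw2, hk2, hr2, hb2, -⟩ := K_pos hε y' v' D hζ
    have e1 : k1 = k := by
      have := K_const hε D S1 S1 hζ h₀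
      rw [hk1, hk] at this; exact_mod_cast this
    have e2 : k2 = k' := by
      have := K_const hε D S2 S2 hζ h₀
      rw [hk2, hk'] at this; exact_mod_cast this
    have e3 : r2 = r1 := by rw [hw1] at hw2; exact_mod_cast hw2.symm
    subst e1 e2 e3
    refine ⟨r2, hw1, hb1, hb2, ?_⟩
    have hK' : Kf p w wz wb ws y v y' v' ζ = 0 := by
      rw [K_conj hε y' v' y v D hζ, hK ζ hζ, map_zero]
    have := w_repr y v y' v' ζ (hW ζ hζ) hK' (hK ζ hζ)
    rw [hk1, hk2, hw1] at this
    exact_mod_cast this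

theorem eig_ext {p : ℂ} {ε : ℝ} (hε : 0 < ε) {Q y v : ℂ → ℂ} (S : Sol p ε Q y v) {l : ℂ}
    (hs : ∀ ζ ∈ HP ε, y (ζ + 2 * Real.pi * Complex.I) = l * y ζ) (m : ℕ) (s : ℝ) (hs1 : s < 1)
    (hl : l = Complex.exp (2 * Real.pi * Complex.I * s)) (C : ℝ)
    (hb : ∀ ζ ∈ HP ε, ‖Complex.exp (m * ζ) * y ζ‖ ≤ C) :
    ∃ g : ℂ → ℂ, AnalyticAt ℂ g p ∧
      ∀ ζ ∈ HP ε, g (p + Complex.exp ζ) = Complex.exp ((m - s) * ζ) * y ζ := by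
  refine descend_ext hε (G := fun ζ => Complex.exp ((m - s) * ζ) * y ζ) (s := s) (C := C) hs1
    (G' := fun ζ => Complex.exp ((m - s) * ζ) * (m - s) * y ζ +
      Complex.exp ((m - s) * ζ) * (Complex.exp ζ * v ζ)) ?_ ?_ ?_ p
  · intro ζ hζ
    rw [hs ζ hζ, hl]
    have e1 : Complex.exp (m * (2 * Real.pi * Complex.I)) = 1 := by
      rw [Complex.exp_nat_mul, Complex.exp_two_pi_mul_I, one_pow]
    have : ((m : ℂ) - s) * (ζ + 2 * Real.pi * Complex.I) = (m - s) * ζ +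
      (m * (2 * Real.pi * Complex.I) + -(2 * Real.pi * Complex.I * s)) := by ring
    rw [this, Complex.exp_add, Complex.exp_add, e1, Complex.exp_neg]
    have := Complex.exp_ne_zero (2 * Real.pi * Complex.I * s)
    field_simp
  · intro ζ hζ
    have h1 : HasDerivAt (fun ζ : ℂ => Complex.exp ((m - s) * ζ))
        (Complex.exp ((m - s) * ζ) * (m - s)) ζ := by
      have := ((hasDerivAt_id ζ).const_mul ((m : ℂ) - s)).cexp
      simpa using this
    exact h1.mul (S ζ hζ).1
  · intro ζ hζ
    have : ((m : ℂ) - s) * ζ = (-s * ζ) + m * ζ := by ring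
    rw [this, Complex.exp_add, mul_assoc, norm_mul, mul_comm, Complex.norm_exp]
    have e : (-(s : ℂ) * ζ).re = -s * ζ.re := by
      rw [← Complex.ofReal_neg, Complex.re_ofReal_mul]
    rw [e]
    exact mul_le_mul_of_nonneg_right (hb ζ hζ) (Real.exp_pos _).le

theorem tendsto_E (p : ℂ) : Tendsto (fun t : ℝ => p + Complex.exp (-(t : ℂ))) atTop (𝓝 p) := by
  have : Tendsto (fun t : ℝ => Complex.exp (-(t : ℂ))) atTop (𝓝 0) := by
    rw [tendsto_zero_iff_norm_tendsto_zero]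
    simp only [Complex.norm_exp, Complex.neg_re, Complex.ofReal_re]
    exact Real.tendsto_exp_neg_atTop_nhds_zero
  simpa using this.const_add p

theorem eventually_HP (ε : ℝ) : ∀ᶠ t : ℝ in atTop, (-(t : ℂ)) ∈ HP ε := by
  filter_upwards [eventually_gt_atTop (-Real.log ε)] with t ht
  simp only [HP, mem_ofPred_eq, Complex.neg_re, Complex.ofReal_re]; linarith

theorem eig_asym {p : ℂ} {ε : ℝ} (hε : 0 < ε) {Q y v : ℂ → ℂ} (S : Sol p ε Q y v) {l : ℂ}
    (hs : ∀ ζ ∈ HP ε, y (ζ + 2 * Real.pi * Complex.I) = l * y ζ) (m : ℕ)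
    (hl : ‖l‖ = 1) (hl1 : l ≠ 1) (C : ℝ)
    (hb : ∀ ζ ∈ HP ε, ‖Complex.exp (m * ζ) * y ζ‖ ≤ C) :
    Tendsto (fun t : ℝ => Complex.exp (m * (-(t : ℂ))) * y (-(t : ℂ))) atTop (𝓝 0) := by
  obtain ⟨s, hs0, hs1, hls⟩ : ∃ s : ℝ, 0 < s ∧ s < 1 ∧
      l = Complex.exp (2 * Real.pi * Complex.I * s) := by
    have h1 : l = Complex.exp (Complex.arg l * Complex.I) := by
      conv_lhs => rw [← Complex.norm_mul_exp_arg_mul_I l]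
      simp [hl]
    have hpi := Real.pi_pos
    have hpiC : (Real.pi : ℂ) ≠ 0 := by exact_mod_cast hpi.ne'
    have ha0 : Complex.arg l ≠ 0 := by
      intro h; rw [h] at h1; simp at h1; exact hl1 h1
    rcases lt_or_gt_of_ne ha0 with h | h
    · refine ⟨Complex.arg l / (2 * Real.pi) + 1, ?_, ?_, ?_⟩
      · have := Complex.neg_pi_lt_arg l
        have : -1 < Complex.arg l / (2 * Real.pi) := by
          rw [lt_div_iff₀ (by positivity)]; linarith
        linarith
      · have : Complex.arg l / (2 * Real.pi) < 0 := div_neg_of_neg_of_pos h (by positivity)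
        linarith
      · conv_lhs => rw [h1]
        rw [← exp_shift]
        congr 1
        push_cast
        field_simp
    · refine ⟨Complex.arg l / (2 * Real.pi), by positivity, ?_, ?_⟩
      · have := Complex.arg_le_pi l
        rw [div_lt_one (by positivity)]; linarith
      · conv_lhs => rw [h1]
        congr 1
        push_cast
        field_simp
  obtain ⟨g, hg, hgE⟩ := eig_ext hε S hs m s hs1 hls C hb
  have h1 : Tendsto (fun t : ℝ => g (p + Complex.exp (-(t : ℂ)))) atTop (𝓝 (g p)) :=
    hg.continuousAt.tendsto.comp (tendsto_E p)
  have h2 : Tendsto (fun t : ℝ => Complex.exp (s * -(t : ℂ))) atTop (𝓝 0) := by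
    rw [tendsto_zero_iff_norm_tendsto_zero]
    have : ∀ t : ℝ, ‖Complex.exp (s * -(t : ℂ))‖ = Real.exp (-(s * t)) := by
      intro t
      rw [Complex.norm_exp, Complex.re_ofReal_mul]; simp
    simp only [this]
    exact Real.tendsto_exp_neg_atTop_nhds_zero.comp (tendsto_id.const_mul_atTop hs0)
  have h3 := h2.mul h1
  rw [zero_mul] at h3
  refine h3.congr' ?_
  filter_upwards [eventually_HP ε] with t ht
  rw [hgE _ ht, ← mul_assoc, ← Complex.exp_add]
  congr 2
  ring

theorem local_thm {p : ℂ} {ε : ℝ} (hε : 0 < ε) {Q w wz wb ws : ℂ → ℂ}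
    (D : LD p ε Q w wz wb ws) (m : ℕ) (c C : ℝ) (hc : 0 < c)
    (hb : ∀ z ∈ ball p ε, z ≠ p → ∀ r : ℝ, w z = r →
      c ≤ r * ‖z - p‖ ^ (2 * m) ∧ r * ‖z - p‖ ^ (2 * m) ≤ C) :
    ∃ y₁ v₁ y₂ v₂ h₁ h₂ : ℂ → ℂ, AnalyticAt ℂ h₁ p ∧ AnalyticAt ℂ h₂ p ∧ (h₁ p ≠ 0 ∨ h₂ p ≠ 0) ∧
      ∀ z ∈ ball p ε, z ≠ p → HasDerivAt y₁ (v₁ z) z ∧ HasDerivAt v₁ (Q z * y₁ z) z ∧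
        HasDerivAt y₂ (v₂ z) z ∧ HasDerivAt v₂ (Q z * y₂ z) z ∧
        y₁ z * v₂ z - y₂ z * v₁ z = 1 ∧ h₁ z = (z - p) ^ m * y₁ z ∧
        h₂ z = (z - p) ^ m * y₂ z := by
  obtain ⟨y, v, y', v', l, l', k, k', S1, S2, hl, hll, hW, hs, hs', hk, hk', hr⟩ :=
    pair_exists hε D
  have hl' : ‖l'‖ = 1 := by
    have := congrArg norm hll
    rw [norm_mul, hl, one_mul, norm_one] at this
    exact this
  have hnE : ∀ ζ : ℂ, ‖Complex.exp (m * ζ)‖ ^ 2 = ‖p + Complex.exp ζ - p‖ ^ (2 * m) := by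
    intro ζ
    rw [add_sub_cancel_left, Complex.exp_nat_mul, norm_pow, ← pow_mul, mul_comm]
  have hB : ∀ (x : ℂ → ℂ) (k : ℝ), 0 ≤ k → (∀ ζ ∈ HP ε, ∃ r : ℝ, w (p + Complex.exp ζ) = r ∧
      ‖x ζ‖ ^ 2 ≤ 8 * k * r) → ∀ ζ ∈ HP ε, ‖Complex.exp (m * ζ) * x ζ‖ ≤ √(8 * k * C) := by
    intro x k hk h ζ hζ
    obtain ⟨r, hr1, hr2⟩ := h ζ hζ
    have hE := HP_exp hε hζ (p := p)
    have h3 := (hb _ hE.1 hE.2 r hr1).2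
    apply Real.le_sqrt_of_sq_le
    rw [norm_mul, mul_pow, hnE]
    calc _ ≤ ‖p + Complex.exp ζ - p‖ ^ (2 * m) * (8 * k * r) := by gcongr
      _ = 8 * k * (r * ‖p + Complex.exp ζ - p‖ ^ (2 * m)) := by ring
      _ ≤ _ := by gcongr
  have hB1 := hB y k hk (fun ζ hζ => by
    obtain ⟨r, h1, h2, h3, h4⟩ := hr ζ hζ; exact ⟨r, h1, h2⟩)
  have hB2 := hB y' k' hk' (fun ζ hζ => by
    obtain ⟨r, h1, h2, h3, h4⟩ := hr ζ hζ; exact ⟨r, h1, h3⟩)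
  have hcontra : ¬ (Tendsto (fun t : ℝ => Complex.exp (m * (-(t : ℂ))) * y (-(t : ℂ))) atTop (𝓝 0) ∧
      Tendsto (fun t : ℝ => Complex.exp (m * (-(t : ℂ))) * y' (-(t : ℂ))) atTop (𝓝 0)) := by
    rintro ⟨t1, t2⟩
    have h := ((t2.norm.pow 2).mul_const k).add ((t1.norm.pow 2).mul_const k')
    simp only [norm_zero, ne_eq, OfNat.ofNat_ne_zero, not_false_eq_true, zero_pow, zero_mul,
      add_zero] at h
    have : c ≤ 0 := by
      refine ge_of_tendsto h ?_
      filter_upwards [eventually_HP ε] with t ht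
      obtain ⟨r, h1, h2, h3, h4⟩ := hr _ ht
      have hE := HP_exp hε ht (p := p)
      have h5 := (hb _ hE.1 hE.2 r h1).1
      refine h5.trans (le_of_eq ?_)
      rw [norm_mul, mul_pow, norm_mul, mul_pow, hnE]
      conv_lhs => rw [h4]
      ring
    linarith
  have hl1 : l = 1 := by
    by_contra hne
    have hne' : l' ≠ 1 := by
      rintro rfl; exact hne (by simpa using hll)
    exact hcontra ⟨eig_asym hε S1 (fun ζ hζ => (hs ζ hζ).1) m hl hne _ hB1,
      eig_asym hε S2 (fun ζ hζ => (hs' ζ hζ).1) m hl' hne' _ hB2⟩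
  have hl1' : l' = 1 := by simpa [hl1] using hll
  subst hl1 hl1'
  obtain ⟨h₁, ha1, he1⟩ := eig_ext hε S1 (fun ζ hζ => (hs ζ hζ).1) m 0 one_pos (by simp) _ hB1
  obtain ⟨h₂, ha2, he2⟩ := eig_ext hε S2 (fun ζ hζ => (hs' ζ hζ).1) m 0 one_pos (by simp) _ hB2
  simp only [Complex.ofReal_zero, sub_zero] at he1 he2
  simp only [one_mul] at hs hs'
  have hT : ∀ (h x : ℂ → ℂ), AnalyticAt ℂ h p → (∀ ζ ∈ HP ε, h (p + Complex.exp ζ) =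
      Complex.exp (m * ζ) * x ζ) → h p = 0 →
      Tendsto (fun t : ℝ => Complex.exp (m * (-(t : ℂ))) * x (-(t : ℂ))) atTop (𝓝 0) := by
    intro h x ha he h0
    have h1 : Tendsto (fun t : ℝ => h (p + Complex.exp (-(t : ℂ)))) atTop (𝓝 (h p)) :=
      ha.continuousAt.tendsto.comp (tendsto_E p)
    rw [h0] at h1
    refine h1.congr' ?_
    filter_upwards [eventually_HP ε] with t ht
    exact he _ ht
  refine ⟨fun z => y (Complex.log (z - p)), fun z => v (Complex.log (z - p)),
    fun z => y' (Complex.log (z - p)), fun z => v' (Complex.log (z - p)), h₁, h₂, ha1, ha2, ?_, ?_⟩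
  · by_contra hcon
    push Not at hcon
    exact hcontra ⟨hT h₁ y ha1 he1 hcon.1, hT h₂ y' ha2 he2 hcon.2⟩
  · intro z hz hzp
    have hz0 : z - p ≠ 0 := sub_ne_zero.2 hzp
    have hL := HP_log hz hzp
    have hexp : Complex.exp (Complex.log (z - p)) = z - p := Complex.exp_log hz0
    have hpE : p + Complex.exp (Complex.log (z - p)) = z := by rw [hexp]; ring
    have d1 := descend_deriv (fun ζ hζ => (hs ζ hζ).1) (fun ζ hζ => (S1 ζ hζ).1) hz hzp
    have d2 := descend_deriv (fun ζ hζ => (hs ζ hζ).2) (fun ζ hζ => (S1 ζ hζ).2) hz hzp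
    have d3 := descend_deriv (fun ζ hζ => (hs' ζ hζ).1) (fun ζ hζ => (S2 ζ hζ).1) hz hzp
    have d4 := descend_deriv (fun ζ hζ => (hs' ζ hζ).2) (fun ζ hζ => (S2 ζ hζ).2) hz hzp
    simp only [hexp, mul_div_cancel_left₀ _ hz0] at d1 d2 d3 d4
    simp only [add_sub_cancel] at d2 d4
    refine ⟨d1, d2, d3, d4, hW _ hL, ?_, ?_⟩
    · have := he1 _ hL
      rwa [hpE, Complex.exp_nat_mul, hexp] at this
    · have := he2 _ hL
      rwa [hpE, Complex.exp_nat_mul, hexp] at this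

/-- Pole form. -/
theorem pole_form {p : ℂ} {ε : ℝ} (hε : 0 < ε) {Q y v h : ℂ → ℂ} (m : ℕ) (hm : 1 ≤ m)
    (ha : AnalyticAt ℂ h p) (h0 : h p ≠ 0)
    (H : ∀ z ∈ ball p ε, z ≠ p → HasDerivAt y (v z) z ∧ HasDerivAt v (Q z * y z) z ∧
      h z = (z - p) ^ m * y z) :
    ∃ g : ℂ → ℂ, AnalyticAt ℂ g p ∧ g p ≠ 0 ∧ ∀ᶠ z in 𝓝[≠] p, Q z = g z / (z - p) ^ 2 := by
  refine ⟨fun z => m * (m + 1) + (z - p) ^ 2 * (deriv (deriv h) z / h z)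
    - 2 * m * (z - p) * (deriv h z / h z), ?_, ?_, ?_⟩
  · have h1 := ha.deriv
    have h2 := h1.deriv
    have hz : AnalyticAt ℂ (fun z : ℂ => z - p) p := by fun_prop
    exact (analyticAt_const.add ((hz.pow 2).mul (h2.div ha h0))).sub
      ((analyticAt_const.mul hz).mul (h1.div ha h0))
  · have : (m : ℂ) ≠ 0 := by exact_mod_cast (by omega : m ≠ 0)
    have h2 : (m : ℂ) + 1 ≠ 0 := by exact_mod_cast (by omega : m + 1 ≠ 0)
    simp [this, h2]
  · have e1 : ∀ᶠ z in 𝓝[≠] p, h z ≠ 0 :=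
      (ha.continuousAt.eventually_ne h0).filter_mono nhdsWithin_le_nhds
    have e2 : ∀ᶠ z in 𝓝[≠] p, z ∈ ball p ε \ {p} :=
      sdiff_mem_nhdsWithin_compl (ball_mem_nhds p hε) _
    filter_upwards [e1, e2] with z hz1 hz2
    have hzp : z ≠ p := hz2.2
    have hz0 : z - p ≠ 0 := sub_ne_zero.2 hzp
    have hO : IsOpen (ball p ε \ {p}) := isOpen_ball.sdiff isClosed_singleton
    obtain ⟨n, rfl⟩ : ∃ n, m = n + 1 := ⟨m - 1, by omega⟩
    have P : ∀ x : ℂ, ∀ k : ℕ, HasDerivAt (fun z => (z - p) ^ k) (k * (x - p) ^ (k - 1)) x := by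
      intro x k
      simpa using ((hasDerivAt_id x).sub_const p).fun_pow k
    have D1 : ∀ x ∈ ball p ε \ {p}, deriv h x =
        ((n + 1 : ℕ) : ℂ) * (x - p) ^ n * y x + (x - p) ^ (n + 1) * v x := by
      intro x hx
      have hd := (P x (n + 1)).mul (H x hx.1 hx.2).1
      refine (HasDerivAt.congr_of_eventuallyEq hd ?_).deriv
      filter_upwards [hO.mem_nhds hx] with x' hx'
      exact (H x' hx'.1 hx'.2).2.2
    have D2 : deriv (deriv h) z = ((n + 1 : ℕ) : ℂ) * (n * (z - p) ^ (n - 1)) * y z +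
        ((n + 1 : ℕ) : ℂ) * (z - p) ^ n * v z + (((n + 1 : ℕ) : ℂ) * (z - p) ^ n * v z +
        (z - p) ^ (n + 1) * (Q z * y z)) := by
      have hd := (((P z n).const_mul ((n + 1 : ℕ) : ℂ)).mul (H z hz2.1 hz2.2).1).add
        ((P z (n + 1)).mul (H z hz2.1 hz2.2).2.1)
      refine (HasDerivAt.congr_of_eventuallyEq hd ?_).deriv
      filter_upwards [hO.mem_nhds hz2] with x' hx'
      rw [D1 x' hx']; rfl
    have hh := (H z hz2.1 hz2.2).2.2
    have hy : y z ≠ 0 := by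
      intro h; rw [hh, h, mul_zero] at hz1; exact hz1 rfl
    rw [D2, D1 z hz2, hh]
    have hn : (n : ℂ) * (z - p) ^ (n - 1) * (z - p) = n * (z - p) ^ n := by
      rcases n with _ | n
      · simp
      · simp [pow_succ]; ring
    have hpn : (z - p) ^ n ≠ 0 := pow_ne_zero _ hz0
    have hn' : (n : ℂ) * (z - p) ^ (n - 1) = n * (z - p) ^ n / (z - p) := by
      rw [eq_div_iff hz0, hn]
    rw [hn']
    push_cast
    field_simp
    ring

theorem apparent_form {p : ℂ} {ε : ℝ} (hε : 0 < ε) {Q y₁ v₁ y₂ v₂ h₁ h₂ : ℂ → ℂ} (m : ℕ)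
    (ha1 : AnalyticAt ℂ h₁ p) (ha2 : AnalyticAt ℂ h₂ p)
    (H : ∀ z ∈ ball p ε, z ≠ p → HasDerivAt y₁ (v₁ z) z ∧ HasDerivAt v₁ (Q z * y₁ z) z ∧
        HasDerivAt y₂ (v₂ z) z ∧ HasDerivAt v₂ (Q z * y₂ z) z ∧
        y₁ z * v₂ z - y₂ z * v₁ z = 1 ∧ h₁ z = (z - p) ^ m * y₁ z ∧
        h₂ z = (z - p) ^ m * y₂ z) :
    ∃ (y₁ y₂ : ℂ → ℂ) (ε : ℝ), 0 < ε ∧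
    (∀ z ∈ Metric.ball p ε, z ≠ p →
      AnalyticAt ℂ y₁ z ∧ AnalyticAt ℂ y₂ z ∧
      deriv (deriv y₁) z = Q z * y₁ z ∧ deriv (deriv y₂) z = Q z * y₂ z) ∧
    MeromorphicAt y₁ p ∧ MeromorphicAt y₂ p ∧
    ∀ a b : ℂ, (∀ z ∈ Metric.ball p ε, z ≠ p → a * y₁ z + b * y₂ z = 0) → a = 0 ∧ b = 0 := by
  have hO : IsOpen (ball p ε \ {p}) := isOpen_ball.sdiff isClosed_singleton
  have A : ∀ y v : ℂ → ℂ, (∀ z ∈ ball p ε \ {p}, HasDerivAt y (v z) z) →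
      ∀ z ∈ ball p ε \ {p}, AnalyticAt ℂ y z := by
    intro y v h z hz
    exact DifferentiableOn.analyticAt (fun x hx => (h x hx).differentiableAt.differentiableWithinAt)
      (hO.mem_nhds hz)
  have B : ∀ y v : ℂ → ℂ, (∀ z ∈ ball p ε \ {p}, HasDerivAt y (v z) z) →
      (∀ z ∈ ball p ε \ {p}, HasDerivAt v (Q z * y z) z) →
      ∀ z ∈ ball p ε \ {p}, deriv (deriv y) z = Q z * y z := by
    intro y v h h' z hz
    refine ((h' z hz).congr_of_eventuallyEq ?_).deriv
    filter_upwards [hO.mem_nhds hz] with x hx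
    exact (h x hx).deriv
  have M : ∀ y h : ℂ → ℂ, AnalyticAt ℂ h p → (∀ z ∈ ball p ε \ {p}, h z = (z - p) ^ m * y z) →
      MeromorphicAt y p := by
    intro y h ha he
    have hz : AnalyticAt ℂ (fun z : ℂ => z - p) p := by fun_prop
    refine (ha.meromorphicAt.div (hz.pow m).meromorphicAt).congr ?_
    have e2 : ∀ᶠ z in 𝓝[≠] p, z ∈ ball p ε \ {p} :=
      sdiff_mem_nhdsWithin_compl (ball_mem_nhds p hε) _
    filter_upwards [e2] with z hz2
    have hz0 : z - p ≠ 0 := sub_ne_zero.2 hz2.2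
    show h z / (z - p) ^ m = y z
    rw [he z hz2]
    field_simp
  have d1 : ∀ z ∈ ball p ε \ {p}, HasDerivAt y₁ (v₁ z) z := fun z hz => (H z hz.1 hz.2).1
  have d2 : ∀ z ∈ ball p ε \ {p}, HasDerivAt v₁ (Q z * y₁ z) z := fun z hz => (H z hz.1 hz.2).2.1
  have d3 : ∀ z ∈ ball p ε \ {p}, HasDerivAt y₂ (v₂ z) z := fun z hz => (H z hz.1 hz.2).2.2.1
  have d4 : ∀ z ∈ ball p ε \ {p}, HasDerivAt v₂ (Q z * y₂ z) z :=
    fun z hz => (H z hz.1 hz.2).2.2.2.1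
  refine ⟨y₁, y₂, ε, hε, ?_, M y₁ h₁ ha1 (fun z hz => (H z hz.1 hz.2).2.2.2.2.2.1),
    M y₂ h₂ ha2 (fun z hz => (H z hz.1 hz.2).2.2.2.2.2.2), ?_⟩
  · intro z hz hzp
    exact ⟨A _ _ d1 z ⟨hz, hzp⟩, A _ _ d3 z ⟨hz, hzp⟩, B _ _ d1 d2 z ⟨hz, hzp⟩,
      B _ _ d3 d4 z ⟨hz, hzp⟩⟩
  · intro a b hab
    have hz : p + ((ε / 2 : ℝ) : ℂ) ∈ ball p ε \ {p} := by
      constructor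
      · simp only [mem_ball, dist_eq_norm, add_sub_cancel_left, Complex.norm_real, Real.norm_eq_abs]
        rw [abs_of_pos (by linarith)]; linarith
      · simp [hε.ne']
    generalize p + ((ε / 2 : ℝ) : ℂ) = z at hz
    have hd := ((d1 z hz).const_mul a).add ((d3 z hz).const_mul b)
    have e0 : (fun z => a * y₁ z + b * y₂ z) =ᶠ[𝓝 z] fun _ => 0 := by
      filter_upwards [hO.mem_nhds hz] with x hx
      exact hab x hx.1 hx.2
    have hd0 : a * v₁ z + b * v₂ z = 0 :=
      hd.unique ((hasDerivAt_const z (0 : ℂ)).congr_of_eventuallyEq e0)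
    have hy0 := hab z hz.1 hz.2
    have hW := (H z hz.1 hz.2).2.2.2.2.1
    constructor
    · linear_combination (-a) * hW + v₂ z * hy0 - y₂ z * hd0
    · linear_combination (-b) * hW + y₁ z * hd0 - v₁ z * hy0

/-- The conjugate Wirtinger derivative. -/
noncomputable def wirtB (g : ℂ → ℂ) (z : ℂ) : ℂ :=
  (1 / 2) * (fderiv ℝ g z (1 : ℂ) + Complex.I * fderiv ℝ g z Complex.I)

theorem HW_of {g : ℂ → ℂ} {z : ℂ} (h : DifferentiableAt ℝ g z) : HW g (wirt g z) (wirtB g z) z :=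
  HW.of_differentiableAt h

theorem cd_apply {F : Type*} [NormedAddCommGroup F] [NormedSpace ℝ F] {g : ℂ → F} {z : ℂ} {n : ℕ}
    (h : ContDiffAt ℝ ((n + 1 : ℕ) : ℕ∞) g z) (v : ℂ) :
    ContDiffAt ℝ (n : ℕ∞) (fun w => fderiv ℝ g w v) z := by
  have := ContDiffAt.fderiv_right (m := ((n : ℕ∞) : WithTop ℕ∞)) h (by norm_cast)
  exact this.clm_apply contDiffAt_const

theorem cd_wirt {g : ℂ → ℂ} {z : ℂ} {n : ℕ} (h : ContDiffAt ℝ ((n + 1 : ℕ) : ℕ∞) g z) :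
    ContDiffAt ℝ (n : ℕ∞) (wirt g) z :=
  contDiffAt_const.mul ((cd_apply h 1).sub (contDiffAt_const.mul (cd_apply h Complex.I)))

theorem cd_wirtB {g : ℂ → ℂ} {z : ℂ} {n : ℕ} (h : ContDiffAt ℝ ((n + 1 : ℕ) : ℕ∞) g z) :
    ContDiffAt ℝ (n : ℕ∞) (wirtB g) z :=
  contDiffAt_const.mul ((cd_apply h 1).add (contDiffAt_const.mul (cd_apply h Complex.I)))

theorem cross_symm {g : ℂ → ℂ} {z : ℂ} (h : ContDiffAt ℝ ((2 : ℕ) : ℕ∞) g z) (v w : ℂ) :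
    fderiv ℝ (fun x => fderiv ℝ g x v) z w = fderiv ℝ (fun x => fderiv ℝ g x w) z v := by
  have hd : DifferentiableAt ℝ (fderiv ℝ g) z :=
    (ContDiffAt.fderiv_right (m := 1) h (by norm_cast)).differentiableAt (by norm_num)
  have e : ∀ v w : ℂ, fderiv ℝ (fun x => fderiv ℝ g x v) z w = fderiv ℝ (fderiv ℝ g) z w v := by
    intro v w
    rw [fderiv_clm_apply hd (differentiableAt_const v)]
    simp
  rw [e, e]
  exact (h.isSymmSndFDerivAt (by simp)).eq w v

theorem wirtB_wirt {g : ℂ → ℂ} {z : ℂ} (h : ContDiffAt ℝ ((2 : ℕ) : ℕ∞) g z) :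
    wirtB (wirt g) z = (1 / 4) * (fderiv ℝ (fun x => fderiv ℝ g x 1) z 1 +
      fderiv ℝ (fun x => fderiv ℝ g x Complex.I) z Complex.I) ∧
    wirt (wirtB g) z = (1 / 4) * (fderiv ℝ (fun x => fderiv ℝ g x 1) z 1 +
      fderiv ℝ (fun x => fderiv ℝ g x Complex.I) z Complex.I) := by
  have d1 : DifferentiableAt ℝ (fun x => fderiv ℝ g x 1) z :=
    (cd_apply (n := 1) h 1).differentiableAt (by norm_num)
  have d2 : DifferentiableAt ℝ (fun x => fderiv ℝ g x Complex.I) z :=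
    (cd_apply (n := 1) h Complex.I).differentiableAt (by norm_num)
  have hs := cross_symm h 1 Complex.I
  have f1 : HasFDerivAt (wirt g) _ z :=
    (d1.hasFDerivAt.sub (d2.hasFDerivAt.const_mul Complex.I)).const_mul (1 / 2)
  have f2 : HasFDerivAt (wirtB g) _ z :=
    (d1.hasFDerivAt.add (d2.hasFDerivAt.const_mul Complex.I)).const_mul (1 / 2)
  have hI := Complex.I_mul_I
  constructor
  · rw [wirtB, f1.fderiv]
    simp only [_root_.smul_apply, _root_.sub_apply, smul_eq_mul]
    linear_combination (Complex.I / 4) * hs - (1 / 4) *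
      fderiv ℝ (fun x => fderiv ℝ g x Complex.I) z Complex.I * hI
  · rw [wirt, f2.fderiv]
    simp only [_root_.smul_apply, _root_.add_apply, smul_eq_mul]
    linear_combination (-Complex.I / 4) * hs - (1 / 4) *
      fderiv ℝ (fun x => fderiv ℝ g x Complex.I) z Complex.I * hI

theorem HW_data {u : ℂ → ℝ} {U : Set ℂ} (hU : IsOpen U)
    (h : ∀ z ∈ U, (∀ n : ℕ, ContDiffAt ℝ n u z) ∧ lapl u z + Real.exp (u z) = 0) :
    ∀ z ∈ U, HW (fun w => ((u w : ℝ) : ℂ)) (wirt (fun w => ((u w : ℝ) : ℂ)) z)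
        ((starRingEnd ℂ) (wirt (fun w => ((u w : ℝ) : ℂ)) z)) z ∧
      HW (wirt (fun w => ((u w : ℝ) : ℂ))) (wirt (wirt (fun w => ((u w : ℝ) : ℂ))) z)
        (-Complex.exp (u z) / 4) z ∧
      HasDerivAt (uPot u) (deriv (uPot u) z) z := by
  have hc : ∀ z ∈ U, ∀ n : ℕ, ContDiffAt ℝ (n : ℕ∞) (fun w => ((u w : ℝ) : ℂ)) z := by
    intro z hz n
    exact Complex.ofRealCLM.contDiff.contDiffAt.comp z ((h z hz).1 n)
  have H1 : ∀ z ∈ U, HW (fun w => ((u w : ℝ) : ℂ)) (wirt (fun w => ((u w : ℝ) : ℂ)) z)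
        ((starRingEnd ℂ) (wirt (fun w => ((u w : ℝ) : ℂ)) z)) z := by
    intro z hz
    have h1 := HW_of ((hc z hz 1).differentiableAt (by norm_num))
    have h2 := h1.conj
    simp only [Complex.conj_ofReal] at h2
    exact h1.congr' rfl (h1.unique h2).2
  have H2 : ∀ z ∈ U, wirtB (wirt (fun w => ((u w : ℝ) : ℂ))) z = -Complex.exp (u z) / 4 := by
    intro z hz
    rw [(wirtB_wirt (hc z hz 2)).1]
    have e : ∀ v w : ℂ, fderiv ℝ (fun x => fderiv ℝ (fun w => ((u w : ℝ) : ℂ)) x v) z w =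
        ((fderiv ℝ (fun x => fderiv ℝ u x v) z w : ℝ) : ℂ) := by
      intro v w
      have e1 : (fun x => fderiv ℝ (fun w => ((u w : ℝ) : ℂ)) x v) =ᶠ[𝓝 z]
          fun x => ((fderiv ℝ u x v : ℝ) : ℂ) := by
        filter_upwards [hU.mem_nhds hz] with x hx
        have hd : DifferentiableAt ℝ u x := ((h x hx).1 1).differentiableAt (by norm_num)
        have := Complex.ofRealCLM.hasFDerivAt.comp x hd.hasFDerivAt
        have e2 := this.fderiv
        change fderiv ℝ (fun w => ((u w : ℝ) : ℂ)) x = _ at e2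
        rw [e2]; rfl
      rw [e1.fderiv_eq]
      have hd : DifferentiableAt ℝ (fun x => fderiv ℝ u x v) z :=
        (cd_apply (n := 1) ((h z hz).1 2) v).differentiableAt (by norm_num)
      have := Complex.ofRealCLM.hasFDerivAt.comp z hd.hasFDerivAt
      have e2 := this.fderiv
      change fderiv ℝ (fun x => ((fderiv ℝ u x v : ℝ) : ℂ)) z = _ at e2
      rw [e2]; rfl
    rw [e, e, ← Complex.ofReal_add]
    have := (h z hz).2
    unfold lapl at this
    rw [eq_neg_of_add_eq_zero_left this]
    push_cast
    ring
  have H3 : ∀ z ∈ U, HW (wirt (fun w => ((u w : ℝ) : ℂ)))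
      (wirt (wirt (fun w => ((u w : ℝ) : ℂ))) z) (-Complex.exp (u z) / 4) z := by
    intro z hz
    exact (HW_of ((cd_wirt (hc z hz 2)).differentiableAt (by norm_num))).congr' rfl (H2 z hz)
  have H4 : ∀ z ∈ U, ∃ c, HW (wirt (wirt (fun w => ((u w : ℝ) : ℂ)))) c
      (-Complex.exp (u z) / 4 * wirt (fun w => ((u w : ℝ) : ℂ)) z) z := by
    intro z hz
    refine ⟨_, (HW_of ((cd_wirt (cd_wirt (hc z hz 3))).differentiableAt (by norm_num))).congr'
      rfl ?_⟩
    have hs := wirtB_wirt (cd_wirt (hc z hz 3))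
    rw [hs.1, ← hs.2]
    have h1 := HW_of ((cd_wirtB (cd_wirt (hc z hz 3))).differentiableAt (by norm_num))
    have h2 := (HW.hol_comp (Complex.hasDerivAt_exp _) (H1 z hz)).const_mul (-1 / 4)
    have h3 := h2.congr_of_eventuallyEq (h := wirtB (wirt (fun w => ((u w : ℝ) : ℂ)))) (by
      filter_upwards [hU.mem_nhds hz] with x hx
      rw [H2 x hx]; ring)
    rw [(h1.unique h3).1]; ring
  intro z hz
  refine ⟨H1 z hz, H3 z hz, ?_⟩
  obtain ⟨c, h4⟩ := H4 z hz
  have h5 := (h4.sub (((H3 z hz).mul (H3 z hz)).const_mul (1 / 2))).const_mul (-(1 / 2))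
  have h6 : ∃ d, HW (uPot u) d 0 z := by
    have : uPot u = fun x => -(1 / 2) * (wirt (wirt (fun w => ((u w : ℝ) : ℂ))) x -
      1 / 2 * (wirt (fun w => ((u w : ℝ) : ℂ)) x * wirt (fun w => ((u w : ℝ) : ℂ)) x)) := by
      ext x; rw [uPot]; ring
    rw [this]
    exact ⟨_, h5.congr' rfl (by ring)⟩
  obtain ⟨d, h6⟩ := h6
  exact h6.hasDerivAt.differentiableAt.hasDerivAt

theorem LD_of {u : ℂ → ℝ} {U : Set ℂ} (hU : IsOpen U)
    (h : ∀ z ∈ U, (∀ n : ℕ, ContDiffAt ℝ n u z) ∧ lapl u z + Real.exp (u z) = 0) {p : ℂ} {ε : ℝ}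
    (hp : ∀ z ∈ ball p ε, z ≠ p → z ∈ U) :
    ∃ wz wb ws : ℂ → ℂ,
      LD p ε (uPot u) (fun z => Complex.exp (-(1 / 2) * u z)) wz wb ws := by
  have HD := HW_data hU h
  set a := wirt (fun w => ((u w : ℝ) : ℂ)) with ha
  have hQ : ∀ z, uPot u z = -(1 / 2) * wirt a z + 1 / 4 * (a z * a z) := by
    intro z; rw [uPot]; ring
  let w : ℂ → ℂ := fun z => Complex.exp (-(1 / 2) * u z)
  have hwc : ∀ z, (starRingEnd ℂ) (w z) = w z := by
    intro z; simp only [w]; rw [← Complex.exp_conj]; simp [Complex.conj_ofNat]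
  have hec : ∀ z, (starRingEnd ℂ) (Complex.exp (u z)) = Complex.exp (u z) := by
    intro z; rw [← Complex.exp_conj]; simp
  have hwe : ∀ z, w z * w z * Complex.exp (u z) = 1 := by
    intro z
    simp only [w]; rw [← Complex.exp_add, ← Complex.exp_add, Complex.exp_eq_one_iff]; exact ⟨0, by push_cast; ring⟩
  have hw : ∀ z ∈ U, HW w (-(1 / 2) * (a z * w z)) (-(1 / 2) * ((starRingEnd ℂ) (a z) * w z)) z := by
    intro z hz
    refine (HW.hol_comp (Complex.hasDerivAt_exp _) ((HD z hz).1.const_mul (-(1 / 2)))).congr' ?_ ?_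
    · simp only [w]; ring
    · simp only [w]; ring
  have he : ∀ z ∈ U, HW (fun z => Complex.exp (u z)) (Complex.exp (u z) * a z)
      (Complex.exp (u z) * (starRingEnd ℂ) (a z)) z := by
    intro z hz
    exact HW.hol_comp (Complex.hasDerivAt_exp _) (HD z hz).1
  have hwz : ∀ z ∈ U, HW (fun z => -(1 / 2) * (a z * w z)) (uPot u z * w z)
      (w z * (1 / 8 * Complex.exp (u z) + 1 / 4 * (a z * (starRingEnd ℂ) (a z)))) z := by
    intro z hz
    refine (((HD z hz).2.1.mul (hw z hz)).const_mul (-(1 / 2))).congr' ?_ ?_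
    · rw [hQ]; ring
    · ring
  have hwb : ∀ z ∈ U, HW (fun z => -(1 / 2) * ((starRingEnd ℂ) (a z) * w z))
      (w z * (1 / 8 * Complex.exp (u z) + 1 / 4 * (a z * (starRingEnd ℂ) (a z))))
      ((starRingEnd ℂ) (uPot u z) * w z) z := by
    intro z hz
    refine (((HD z hz).2.1.conj.mul (hw z hz)).const_mul (-(1 / 2))).congr' ?_ ?_
    · simp only [map_neg, map_div₀, hec, Complex.conj_ofNat]; ring
    · rw [hQ]; simp only [map_add, map_mul, map_neg, map_div₀, map_one, Complex.conj_ofNat]; ring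
  have hws : ∀ z ∈ U, HW (fun z => w z * (1 / 8 * Complex.exp (u z) +
        1 / 4 * (a z * (starRingEnd ℂ) (a z))))
      (uPot u z * (-(1 / 2) * ((starRingEnd ℂ) (a z) * w z)))
      ((starRingEnd ℂ) (uPot u z) * (-(1 / 2) * (a z * w z))) z := by
    intro z hz
    refine ((hw z hz).mul (((he z hz).const_mul (1 / 8)).add
      (((HD z hz).2.1.mul (HD z hz).2.1.conj).const_mul (1 / 4)))).congr' ?_ ?_
    · rw [hQ]; simp only [map_neg, map_div₀, hec, Complex.conj_ofNat]; ring
    · rw [hQ]; simp only [map_add, map_mul, map_neg, map_div₀, map_one, Complex.conj_ofNat]; ring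
  refine ⟨_, _, _, ⟨fun z hz hzp => hw z (hp z hz hzp), fun z hz hzp => hwz z (hp z hz hzp),
    fun z hz hzp => hwb z (hp z hz hzp), fun z hz hzp => hws z (hp z hz hzp), ?_, ?_, ?_, ?_, ?_⟩⟩
  · intro z _ _
    show w z * _ - _ = _
    linear_combination (1 / 8) * hwe z
  · intro z hz hzp
    exact (HD z (hp z hz hzp)).2.2.differentiableAt
  · intro z _ _
    simp only [map_mul, map_neg, map_div₀, map_one, Complex.conj_ofNat, hwc]
  · intro z _ _
    refine ⟨Real.exp (-(1 / 2) * u z), Real.exp_pos _, ?_⟩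
    push_cast; rfl
  · intro z _ _
    refine ⟨Real.exp (-(1 / 2) * u z) * (1 / 8 * Real.exp (u z) + 1 / 4 * ‖a z‖ ^ 2), ?_⟩
    rw [Complex.mul_conj']
    push_cast; rfl

theorem sing_half {τ : ℂ} {m : Fin 4 → ℕ} {z : ℂ} (hz : z ∈ singSet τ m) :
    ∃ i j : ℤ, z = ((i : ℂ) + (j : ℂ) * τ) / 2 := by
  obtain ⟨k, -, l, ⟨a, b, rfl⟩, rfl⟩ := hz
  fin_cases k
  · exact ⟨2 * a, 2 * b, by simp only [per]; push_cast; ring⟩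
  · exact ⟨2 * a + 1, 2 * b, by simp only [per]; push_cast; ring⟩
  · exact ⟨2 * a, 2 * b + 1, by simp only [per]; push_cast; ring⟩
  · exact ⟨2 * a + 1, 2 * b + 1, by simp only [per]; push_cast; ring⟩

theorem sing_sep {τ : ℂ} (hτ : 0 < τ.im) (m : Fin 4 → ℕ) :
    ∃ δ : ℝ, 0 < δ ∧ ∀ x ∈ singSet τ m, ∀ y ∈ singSet τ m, x ≠ y → δ ≤ dist x y := by
  refine ⟨min 1 τ.im / 2, by positivity, ?_⟩
  intro x hx y hy hxy
  obtain ⟨i, j, rfl⟩ := sing_half hx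
  obtain ⟨i', j', rfl⟩ := sing_half hy
  rw [dist_eq_norm]
  have habs : ∀ a b : ℤ, a ≠ b → (1 : ℝ) ≤ |(a : ℝ) - b| := by
    intro a b hab
    have : 1 ≤ |a - b| := Int.one_le_abs (sub_ne_zero.2 hab)
    exact_mod_cast this
  by_cases hj : j = j'
  · subst hj
    have hi : i ≠ i' := by rintro rfl; exact hxy rfl
    have e : ((i : ℂ) + (j : ℂ) * τ) / 2 - ((i' : ℂ) + (j : ℂ) * τ) / 2 =
      (((i - i' : ℝ) / 2 : ℝ) : ℂ) := by push_cast; ring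
    rw [e, Complex.norm_real, Real.norm_eq_abs, abs_div, abs_two]
    have := habs i i' hi
    have := min_le_left 1 τ.im
    linarith
  · refine le_trans ?_ (Complex.abs_im_le_norm _)
    have e : (((i : ℂ) + (j : ℂ) * τ) / 2 - ((i' : ℂ) + (j' : ℂ) * τ) / 2).im =
      (j - j' : ℝ) * (τ.im / 2) := by
      have : ((i : ℂ) + (j : ℂ) * τ) / 2 - ((i' : ℂ) + (j' : ℂ) * τ) / 2 =
        (((i - i') / 2 : ℝ) : ℂ) + (((j - j') / 2 : ℝ) : ℂ) * τ := by push_cast; ring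
      rw [this, Complex.add_im, Complex.im_ofReal_mul, Complex.ofReal_im]; ring
    rw [e, abs_mul, abs_of_pos (half_pos hτ)]
    have h1 := habs j j' hj
    have := min_le_right 1 τ.im
    nlinarith

theorem wirt_shift {g : ℂ → ℂ} {c : ℂ} (h : ∀ z, g (z + c) = g z) (z : ℂ) :
    wirt g (z + c) = wirt g z := by
  have : fderiv ℝ g (z + c) = fderiv ℝ g z := by
    rw [← fderiv_comp_add_right]
    simp only [h]
  simp only [wirt, this]

theorem uPot_shift {u : ℂ → ℝ} {c : ℂ} (h : ∀ z, u (z + c) = u z) (z : ℂ) :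
    uPot u (z + c) = uPot u z := by
  have h1 : ∀ z, wirt (fun w => ((u w : ℝ) : ℂ)) (z + c) = wirt (fun w => ((u w : ℝ) : ℂ)) z :=
    wirt_shift (fun z => by simp only [h])
  simp only [uPot, h1, wirt_shift h1]

theorem sing_local {τ : ℂ} (hτ : 0 < τ.im) {m : Fin 4 → ℕ}
    {u : ℂ → ℝ} (hu : IsCurvatureSolution τ m u) (hO : IsOpen (singSet τ m)ᶜ) {p : ℂ}
    (hp : p ∈ singSet τ m) :
    ∃ (k : ℕ) (ε : ℝ), 1 ≤ k ∧ 0 < ε ∧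
    ∃ y₁ v₁ y₂ v₂ h₁ h₂ : ℂ → ℂ, AnalyticAt ℂ h₁ p ∧ AnalyticAt ℂ h₂ p ∧ (h₁ p ≠ 0 ∨ h₂ p ≠ 0) ∧
      ∀ z ∈ ball p ε, z ≠ p → HasDerivAt y₁ (v₁ z) z ∧ HasDerivAt v₁ (uPot u z * y₁ z) z ∧
        HasDerivAt y₂ (v₂ z) z ∧ HasDerivAt v₂ (uPot u z * y₂ z) z ∧
        y₁ z * v₂ z - y₂ z * v₁ z = 1 ∧ h₁ z = (z - p) ^ k * y₁ z ∧
        h₂ z = (z - p) ^ k * y₂ z := by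
  obtain ⟨δ, hδ, hsep⟩ := sing_sep hτ m
  have hp' := hp
  obtain ⟨k, hk, l, hl, rfl⟩ := hp'
  obtain ⟨C, ε, hε, hC⟩ := hu.2.2.2 k hk l hl
  generalize per τ (k : ℕ) / 2 + l = p at *
  have hε' : 0 < min ε δ := lt_min hε hδ
  obtain ⟨wz, wb, ws, D⟩ := LD_of hO hu.2.2.1 (p := p) (ε := min ε δ) (by
    intro z hz hzp hzS
    have := hsep z hzS p hp hzp
    have h2 : dist z p < min ε δ := hz
    exact absurd (h2.trans_le (min_le_right _ _)) (not_lt.2 this))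
  refine ⟨m k, min ε δ, hk, hε', local_thm hε' D (m k) (Real.exp (-C / 2)) (Real.exp (C / 2))
    (Real.exp_pos _) ?_⟩
  intro z hz hzp r hr
  have hd : dist z p < ε := lt_of_lt_of_le hz (min_le_left _ _)
  have hb := abs_le.1 (hC z hzp hd)
  have hr' : r = Real.exp (-(1 / 2) * u z) := by
    have : ((Real.exp (-(1 / 2) * u z) : ℝ) : ℂ) = r := by rw [← hr]; push_cast; rfl
    exact_mod_cast this.symm
  have hpos : 0 < ‖z - p‖ := norm_pos_iff.2 (sub_ne_zero.2 hzp)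
  rw [dist_eq_norm] at hb
  have e : r * ‖z - p‖ ^ (2 * m k) =
      Real.exp (-(u z - 4 * (m k : ℝ) * Real.log ‖z - p‖) / 2) := by
    rw [hr']
    conv_lhs => rw [← Real.exp_log hpos, ← Real.exp_nat_mul, ← Real.exp_add]
    congr 1
    push_cast
    ring
  rw [e]
  constructor
  · apply Real.exp_le_exp.2; linarith
  · apply Real.exp_le_exp.2; linarith

/-- **Theorem (Statement 9).** For a solution `u` of the curvature equation, the potential
`q = -(1/2)(u_zz - (1/2)u_z²)` extends to an elliptic function with poles of order 2 exactly
at the lattice translates of the `ω_k/2` with `m_k ≥ 1`, and `y″ = q·y` is apparent at each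
such singular point. -/
theorem statement9 (τ : ℂ) (hτ : 0 < τ.im) (m : Fin 4 → ℕ) (hm : 1 ≤ ∑ k, m k)
    (u : ℂ → ℝ) (hu : IsCurvatureSolution τ m u) :
    ∃ Q : ℂ → ℂ,
      (∀ z ∉ singSet τ m, Q z = uPot u z) ∧
      (∀ z, Q (z + 1) = Q z) ∧ (∀ z, Q (z + τ) = Q z) ∧
      (∀ z ∉ singSet τ m, AnalyticAt ℂ Q z) ∧
      (∀ p ∈ singSet τ m, ∃ g : ℂ → ℂ, AnalyticAt ℂ g p ∧ g p ≠ 0 ∧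
        ∀ᶠ z in 𝓝[≠] p, Q z = g z / (z - p) ^ 2) ∧
      (∀ p ∈ singSet τ m, ApparentAt Q p) := by
  obtain ⟨δ, hδ, hsep⟩ := sing_sep hτ m
  have hcl : IsClosed (singSet τ m) :=
    Metric.isClosed_of_pairwise_le_dist hδ (fun x hx y hy hxy => hsep x hx y hy hxy)
  have hO : IsOpen (singSet τ m)ᶜ := hcl.isOpen_compl
  refine ⟨uPot u, fun _ _ => rfl, uPot_shift hu.1, uPot_shift hu.2.1, ?_, ?_, ?_⟩
  · intro z hz
    exact DifferentiableOn.analyticAt (s := (singSet τ m)ᶜ)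
      (fun x hx => (HW_data hO hu.2.2.1 x hx).2.2.differentiableAt.differentiableWithinAt)
      (hO.mem_nhds hz)
  · intro p hp
    obtain ⟨k, ε, hk, hε, y₁, v₁, y₂, v₂, h₁, h₂, a1, a2, h0, H⟩ := sing_local hτ hu hO hp
    rcases h0 with h0 | h0
    · exact pole_form hε k hk a1 h0 (fun z hz hzp =>
        ⟨(H z hz hzp).1, (H z hz hzp).2.1, (H z hz hzp).2.2.2.2.2.1⟩)
    · exact pole_form hε k hk a2 h0 (fun z hz hzp =>
        ⟨(H z hz hzp).2.2.1, (H z hz hzp).2.2.2.1, (H z hz hzp).2.2.2.2.2.2⟩)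
  · intro p hp
    obtain ⟨k, ε, hk, hε, y₁, v₁, y₂, v₂, h₁, h₂, a1, a2, h0, H⟩ := sing_local hτ hu hO hp
    exact apparent_form hε k a1 a2 H
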